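/- arXiv:2209.06658 — 4 statements merged into one kernel-verified Lean document; each statement's English description precedes it below -/
import Mathlib

section
/- Let q = p^s with p an odd prime, ψ the canonical additive character of F_{q^n}, Tr the trace from F_{q^n} to F_q, η₂ the quadratic character of F_q*, and τ = 1 if p ≡ 1 (mod 4), τ = i if p ≡ 3 (mod 4). Then for c ∈ F_{q^n}*: the sum Σ_{x ∈ F_{q^n}} ψ(c·x·Tr(x)) equals (−1)^{s+1}·η₂(c)·τ^s·q^{n−1/2} if c ∈ F_q*, and equals q^{n−1} if c ∈ F_{q^n} \ F_q. -/
/-- The canonical additive character `ψ(x) = exp(2πi·Tr_{F/F_p}(x)/p)`. -/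
noncomputable def psiC (p : ℕ) [Fact p.Prime] (F : Type) [Field F] [Fintype F] [CharP F p]
    (x : F) : ℂ :=
  letI : Algebra (ZMod p) F := ZMod.algebra F p
  Complex.exp (2 * Real.pi * Complex.I * ((Algebra.trace (ZMod p) F x).val : ℂ) / p)

/-- `τ = 1` if `p ≡ 1 (mod 4)`, `τ = i` if `p ≡ 3 (mod 4)`. -/
noncomputable def tauC (p : ℕ) : ℂ := if p % 4 = 1 then 1 else Complex.I

/-- The quadratic character of a finite field, with complex values. -/
noncomputable def complexQuadraticChar (F : Type*) [Field F] [Fintype F] [DecidableEq F] :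
    MulChar F ℂ :=
  (quadraticChar F).ringHomComp (Int.castRingHom ℂ)

theorem isQuadratic_complexQuadraticChar (F : Type*) [Field F] [Fintype F] [DecidableEq F] :
    (complexQuadraticChar F).IsQuadratic :=
  (quadraticChar_isQuadratic F).comp _

theorem complexQuadraticChar_ne_one {F : Type*} [Field F] [Fintype F] [DecidableEq F]
    (hF : ringChar F ≠ 2) : complexQuadraticChar F ≠ 1 :=
  (MulChar.ringHomComp_ne_one_iff Int.cast_injective).mpr (quadraticChar_ne_one hF)

theorem eq_complexQuadraticChar_of_orderOf_eq_two {F : Type*} [Field F] [Fintype F]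
    [DecidableEq F] (hF : ringChar F ≠ 2) {η : MulChar F ℂ} (hη : orderOf η = 2) :
    η = complexQuadraticChar F := by
  obtain ⟨g, hg⟩ := IsCyclic.exists_generator (α := Fˣ)
  have key : ∀ χ : MulChar F ℂ, χ ≠ 1 → χ ^ 2 = 1 → χ g = -1 := by
    intro χ h1 h2
    have hsq : χ g ^ 2 = 1 := by
      rw [← MulChar.pow_apply_coe, h2, MulChar.one_apply_coe]
    rcases eq_or_eq_neg_of_sq_eq_sq _ 1 (hsq.trans (one_pow 2).symm) with h | h
    · exact absurd ((MulChar.eq_iff hg χ 1).mpr (by rw [h, MulChar.one_apply_coe])) h1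
    · exact h
  rw [MulChar.eq_iff hg, key _ (complexQuadraticChar_ne_one hF), key η]
  · rintro rfl
    simp at hη
  · rw [← hη, pow_orderOf_eq_one]
  · exact (isQuadratic_complexQuadraticChar F).sq_eq_one

theorem sum_addChar_mul_sq {F : Type*} [Field F] [Fintype F] [DecidableEq F]
    (hF : ringChar F ≠ 2) {ψ : AddChar F ℂ} (hψ : ψ ≠ 1) {a : F} (ha : a ≠ 0) :
    ∑ x, ψ (a * x ^ 2) = complexQuadraticChar F a * gaussSum (complexQuadraticChar F) ψ := by
  set χ := complexQuadraticChar F with hχ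
  have hprim := AddChar.IsPrimitive.of_ne_one hψ
  have h1 : ∑ x, ψ (a * x ^ 2) = ∑ u, (χ u + 1) * ψ (a * u) := by
    rw [← Finset.sum_fiberwise Finset.univ (fun x : F ↦ x ^ 2)]
    refine Finset.sum_congr rfl fun u _ ↦ ?_
    have hc := congrArg (Int.cast (R := ℂ)) (quadraticChar_card_sqrts hF u)
    push_cast at hc
    rw [Finset.sum_congr rfl (g := fun _ ↦ ψ (a * u))
      (fun x hx ↦ by rw [(Finset.mem_filter.mp hx).2]), Finset.sum_const, nsmul_eq_mul]
    congr 1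
    rw [hχ, complexQuadraticChar, MulChar.ringHomComp_apply, eq_intCast, ← hc]
    congr 2
    ext x
    simp
  have h2 : ∑ u, ψ (a * u) = 0 := by
    simp_rw [mul_comm a]
    rw [AddChar.sum_mulShift a hprim]
    simp [ha]
  have hsq : χ a * χ a = 1 := by
    rw [← sq, ← MulChar.pow_apply' _ two_ne_zero,
      (isQuadratic_complexQuadraticChar F).sq_eq_one,
      MulChar.one_apply (Ne.isUnit ha)]
  have h3 := gaussSum_mulShift χ ψ (Units.mk0 a ha)
  rw [Units.val_mk0] at h3
  rw [h1, ← h3, ← mul_assoc, hsq, one_mul]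
  simp_rw [add_mul, one_mul, Finset.sum_add_distrib, h2, add_zero]
  rfl

theorem sum_addChar_sq {F : Type*} [Field F] [Fintype F] [DecidableEq F]
    (hF : ringChar F ≠ 2) {ψ : AddChar F ℂ} (hψ : ψ ≠ 1) :
    ∑ x, ψ (x ^ 2) = gaussSum (complexQuadraticChar F) ψ := by
  simpa using sum_addChar_mul_sq hF hψ one_ne_zero

/-- Summing over a finite group a function that factors through a surjective homomorphism. -/
theorem card_mul_sum_comp_of_surjective {G H : Type*} [AddGroup G] [AddGroup H] [Fintype G]
    [Fintype H] (f : G →+ H) (hf : Function.Surjective f) (φ : H → ℂ) :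
    (Fintype.card H : ℂ) * ∑ x, φ (f x) = Fintype.card G * ∑ y, φ y := by
  classical
  have hfib : ∀ y : H, (Finset.univ.filter fun x ↦ f x = y).card =
      (Finset.univ.filter fun x ↦ f x = 0).card := fun y ↦
    AddMonoidHom.card_fiber_eq_of_mem_range f (hf y) (hf 0)
  have hcard : Fintype.card G = Fintype.card H * (Finset.univ.filter fun x ↦ f x = 0).card := by
    rw [← Finset.card_univ, Finset.card_eq_sum_card_fiberwise (f := f) (t := Finset.univ)
      (fun _ _ ↦ Finset.mem_coe.mpr (Finset.mem_univ _)), Finset.sum_congr rfl fun y _ ↦ hfib y]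
    simp
  rw [← Finset.sum_fiberwise Finset.univ f, hcard]
  push_cast
  rw [mul_assoc, Finset.mul_sum _ _ ((Finset.card _ : ℕ) : ℂ)]
  congr 1
  refine Finset.sum_congr rfl fun y _ ↦ ?_
  rw [Finset.sum_congr rfl (g := fun _ ↦ φ y)
    (fun x hx ↦ by rw [(Finset.mem_filter.mp hx).2]), Finset.sum_const, nsmul_eq_mul, hfib]

/-- The discriminant of an extension of finite fields, by Euler's criterion: it is a square exactly
when the degree is odd. -/
theorem discr_pow_card_div_two {K L : Type*} [Field K] [Field L] [Fintype K] [Fintype L]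
    [Algebra K L] (hK : Odd (Fintype.card K)) {s : ℕ} (b : Module.Basis (Fin s) K L) :
    Algebra.discr K b ^ (Fintype.card K / 2) = (-1) ^ (s - 1) := by
  set q := Fintype.card K with hq
  have hs : Module.finrank K L = s := by rw [Module.finrank_eq_card_basis b, Fintype.card_fin]
  set M : Matrix (Fin s) (Fin s) L := Matrix.of fun i j ↦ b j ^ q ^ (i : ℕ) with hM
  have hLcard : ∀ x : L, x ^ q ^ s = x := fun x ↦ by
    rw [← hs, hq, ← Module.card_eq_pow_finrank, FiniteField.pow_card]
  have hdiscr : algebraMap K L (Algebra.discr K b) = M.det ^ 2 := by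
    rw [Algebra.discr_def, RingHom.map_det, sq]
    nth_rw 1 [← Matrix.det_transpose M]
    rw [← Matrix.det_mul]
    congr 1
    ext i j
    rw [RingHom.mapMatrix_apply, Matrix.map_apply, Algebra.traceMatrix_apply,
      Algebra.traceForm_apply, FiniteField.algebraMap_trace_eq_sum_pow, Matrix.mul_apply,
      ← Fin.sum_univ_eq_sum_range (fun k ↦ (b i * b j) ^ Nat.card K ^ k), hs]
    simp [hM, mul_pow, hq]
  have hfrob : M.det ^ q = (-1) ^ (s - 1) * M.det := by
    have h1 : M.det ^ q = (FiniteField.frobeniusAlgHom K L : L →+* L) M.det := by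
      simp [hq]
    have h2 : (FiniteField.frobeniusAlgHom K L : L →+* L).mapMatrix M
        = M.submatrix (finRotate s) id := by
      ext i j
      rcases s with _ | s
      · exact i.elim0
      simp only [RingHom.mapMatrix_apply, Matrix.map_apply, hM, Matrix.of_apply,
        Matrix.submatrix_apply, id]
      rcases eq_or_ne i (Fin.last s) with rfl | hi
      · simp only [finRotate_last, Fin.val_zero, pow_zero, pow_one, Fin.val_last]
        simpa [← hq, ← pow_mul, ← pow_succ] using hLcard (b j)
      · rw [coe_finRotate_of_ne_last hi]
        simp [← hq, ← pow_mul, ← pow_succ]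
    rw [h1, RingHom.map_det, h2, Matrix.det_permute, sign_finRotate]
    push_cast
    rfl
  have hne : M.det ≠ 0 := by
    intro h0
    rw [h0, zero_pow two_ne_zero, map_eq_zero] at hdiscr
    exact Algebra.discr_not_zero_of_basis K b hdiscr
  apply (algebraMap K L).injective
  rw [map_pow, hdiscr, ← pow_mul, map_pow, map_neg, map_one]
  apply mul_right_cancel₀ hne
  rw [← pow_succ, Nat.two_mul_div_two_add_one_of_odd hK, hfrob]

open Polynomial in
/-- The Euler operator `f ↦ X * f'` on polynomials. -/
noncomputable def eulerOp (R : Type*) [CommRing R] : R[X] →ₗ[R] R[X] :=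
  LinearMap.mulLeft R X ∘ₗ derivative

open Polynomial in
theorem eulerOp_pow_X_pow {R : Type*} [CommRing R] (m j : ℕ) :
    (eulerOp R ^ m) (X ^ j) = C ((j : R) ^ m) * X ^ j := by
  induction m with
  | zero => simp
  | succ m ih =>
    rw [pow_succ', Module.End.mul_apply, ih, eulerOp, LinearMap.comp_apply,
      derivative_C_mul_X_pow, LinearMap.mulLeft_apply]
    rcases j with _ | j
    · simp
    · simp only [Nat.add_sub_cancel, C_mul, C_pow, pow_succ]
      ring

open Polynomial in
theorem eval_one_eulerOp_pow {R : Type*} [CommRing R] (m : ℕ) (h : R[X]) :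
    ((eulerOp R ^ m) ((X - 1) ^ m * h)).eval 1 = m.factorial * h.eval 1 := by
  induction m generalizing h with
  | zero => simp
  | succ m ih =>
    have h1 : eulerOp R ((X - 1) ^ (m + 1) * h) =
        (X - 1) ^ m * (X * ((m + 1 : R[X]) * h + (X - 1) * derivative h)) := by
      simp only [eulerOp, LinearMap.comp_apply, LinearMap.mulLeft_apply, derivative_mul,
        derivative_pow, derivative_sub, derivative_X, derivative_one, Nat.add_sub_cancel]
      simp
      ring
    rw [pow_succ, Module.End.mul_apply, h1, ih]
    simp [Nat.factorial_succ]
    ring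

open Polynomial in
theorem cyclotomic_zmod_eq_X_sub_one_pow (p : ℕ) [hp : Fact p.Prime] :
    cyclotomic p (ZMod p) = (X - 1) ^ (p - 1) := by
  have h := cyclotomic_prime_mul_X_sub_one (ZMod p) p
  apply mul_right_cancel₀ (X_sub_C_ne_zero (1 : ZMod p))
  rw [C_1, h, ← pow_succ, Nat.sub_add_cancel hp.out.one_le, sub_pow_char, one_pow]

theorem isPrimitiveRoot_stdAddChar_one (p : ℕ) [Fact p.Prime] :
    IsPrimitiveRoot (ZMod.stdAddChar (1 : ZMod p)) p := by
  have h := ZMod.stdAddChar_coe (N := p) 1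
  rw [Int.cast_one, Int.cast_one, mul_one] at h
  rw [h]
  exact Complex.isPrimitiveRoot_exp p (NeZero.ne p)

theorem stdAddChar_eq_pow_val (p : ℕ) [Fact p.Prime] (j : ZMod p) :
    ZMod.stdAddChar j = ZMod.stdAddChar (1 : ZMod p) ^ j.val := by
  rw [← AddChar.map_nsmul_eq_pow, nsmul_one, ZMod.natCast_zmod_val]

/-- Half of Wilson's theorem: `((p-1)/2)!² = -(-1)^((p-1)/2)` modulo `p`. -/
theorem factorial_half_sq (p m : ℕ) [Fact p.Prime] (hm : p = 2 * m + 1) :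
    (-1 : ZMod p) ^ m * (m.factorial : ZMod p) ^ 2 = -1 := by
  have hw := ZMod.wilsons_lemma p
  have h1 : (p - 1).factorial = m.factorial * ∏ a ∈ Finset.range m, (p - (a + 1)) := by
    rw [← Finset.prod_range_add_one_eq_factorial, ← Finset.prod_range_add_one_eq_factorial,
      show p - 1 = m + m by lia, Finset.prod_range_add]
    congr 1
    rw [← Finset.prod_range_reflect]
    refine Finset.prod_congr rfl fun a ha ↦ ?_
    have := Finset.mem_range.mp ha
    lia
  have h2 : ((∏ a ∈ Finset.range m, (p - (a + 1)) : ℕ) : ZMod p)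
      = (-1) ^ m * (m.factorial : ZMod p) := by
    rw [← Finset.prod_range_add_one_eq_factorial, Nat.cast_prod, Nat.cast_prod,
      ← Finset.card_range m, ← Finset.prod_const, Finset.card_range, ← Finset.prod_mul_distrib]
    refine Finset.prod_congr rfl fun a ha ↦ ?_
    have := Finset.mem_range.mp ha
    rw [Nat.cast_sub (by lia), CharP.cast_eq_zero]
    ring
  rw [h1, Nat.cast_mul, h2] at hw
  linear_combination hw

open Polynomial in
/-- If the quadratic Gauss sum agrees up to a sign with `∏ (ζ ^ a - ζ ^ (-a))`, the sign is
determined modulo `p`. -/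
theorem sign_eq_neg_two_pow (p m : ℕ) [Fact p.Prime] (hm : p = 2 * m + 1) (ε : ℤ)
    (hε : ∑ y : ZMod p, ZMod.stdAddChar (y ^ 2) = ε * ∏ a ∈ Finset.range m,
      (ZMod.stdAddChar (1 : ZMod p) ^ (a + 1) - ZMod.stdAddChar (1 : ZMod p) ^ (p - (a + 1)))) :
    (ε : ZMod p) = (-2) ^ m := by
  have hp := (Fact.out : p.Prime)
  have hm0 : m ≠ 0 := by rintro rfl; exact hp.one_lt.ne' hm
  set ζ := ZMod.stdAddChar (1 : ZMod p) with hζ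
  have hprim := isPrimitiveRoot_stdAddChar_one p
  set f : ℤ[X] := ∑ y : ZMod p, X ^ (y ^ 2).val -
    C ε * ∏ a ∈ Finset.range m, (X ^ (a + 1) - X ^ (p - (a + 1))) with hf
  have hroot : aeval ζ f = 0 := by
    simp_rw [stdAddChar_eq_pow_val p (_ ^ 2)] at hε
    simp only [← hζ] at hε
    simp [hf, hε]
  have hdvd : cyclotomic p ℤ ∣ f := by
    rw [cyclotomic_eq_minpoly hprim hp.pos]
    exact minpoly.isIntegrallyClosed_dvd (hprim.isIntegral hp.pos) hroot
  obtain ⟨k, hk⟩ := (Polynomial.map_dvd (Int.castRingHom (ZMod p)) hdvd)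
  rw [map_cyclotomic, cyclotomic_zmod_eq_X_sub_one_pow, show p - 1 = m + m by lia, pow_add,
    mul_assoc] at hk
  have hzero : ((eulerOp (ZMod p) ^ m) (f.map (Int.castRingHom (ZMod p)))).eval 1 = 0 := by
    rw [hk, eval_one_eulerOp_pow]
    simp [hm0]
  have hfac : ∀ a ∈ Finset.range m, ∃ h : (ZMod p)[X],
      X ^ (a + 1) - X ^ (p - (a + 1)) = (X - 1) * h ∧ h.eval 1 = 2 * ((a + 1 : ℕ) : ZMod p) := by
    intro a ha
    have ha' := Finset.mem_range.mp ha
    obtain ⟨h, hh⟩ : X - C 1 ∣ (X ^ (a + 1) - X ^ (p - (a + 1)) : (ZMod p)[X]) :=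
      dvd_iff_isRoot.mpr (by simp)
    refine ⟨h, by simpa using hh, ?_⟩
    have hd := congrArg (fun g ↦ eval 1 (derivative g)) hh
    simp only [derivative_sub, derivative_X_pow, derivative_mul, derivative_X, derivative_C] at hd
    simp only [eval_add, eval_sub, eval_mul, eval_pow, eval_X, eval_C, one_pow, sub_self,
      zero_mul, add_zero, one_mul, sub_zero, mul_one] at hd
    rw [← hd, Nat.cast_sub (by lia), CharP.cast_eq_zero (ZMod p) p]
    ring
  choose! h hh1 hh2 using hfac
  have hprod : ((eulerOp (ZMod p) ^ m)
      (∏ a ∈ Finset.range m, (X ^ (a + 1) - X ^ (p - (a + 1))))).eval 1 =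
      2 ^ m * (m.factorial : ZMod p) ^ 2 := by
    rw [Finset.prod_congr rfl hh1, Finset.prod_mul_distrib, Finset.prod_const, Finset.card_range,
      eval_one_eulerOp_pow, eval_prod, Finset.prod_congr rfl hh2, Finset.prod_mul_distrib,
      Finset.prod_const, Finset.card_range, ← Nat.cast_prod,
      Finset.prod_range_add_one_eq_factorial]
    ring
  have hsum : ((eulerOp (ZMod p) ^ m) (∑ y : ZMod p, X ^ (y ^ 2).val)).eval 1 = -1 := by
    rw [map_sum, eval_finsetSum]
    simp_rw [eulerOp_pow_X_pow, eval_mul, eval_C, eval_pow, eval_X, one_pow, mul_one,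
      ZMod.natCast_zmod_val, ← pow_mul]
    rw [← Finset.sum_erase_add _ _ (Finset.mem_univ (0 : ZMod p)), zero_pow (by lia), add_zero,
      Finset.sum_congr rfl (g := fun _ ↦ 1) fun y hy ↦ by
        rw [show 2 * m = p - 1 by lia, ZMod.pow_card_sub_one_eq_one (Finset.ne_of_mem_erase hy)]]
    simp [Finset.card_erase_of_mem, hp.one_le]
  have hmap : f.map (Int.castRingHom (ZMod p)) = ∑ y : ZMod p, X ^ (y ^ 2).val -
      (ε : ZMod p) • ∏ a ∈ Finset.range m, (X ^ (a + 1) - X ^ (p - (a + 1))) := by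
    simp [hf, Polynomial.map_sum, Polynomial.map_prod, smul_eq_C_mul]
  rw [hmap, map_sub, map_smul, eval_sub, eval_smul, hsum, hprod, smul_eq_mul] at hzero
  have hw := factorial_half_sq p m hm
  have h22 : (-2 : ZMod p) ^ m = (-1) ^ m * 2 ^ m := by rw [← mul_pow]; norm_num
  have h2 : (ε : ZMod p) * 2 ^ m = (-1) ^ m := by
    linear_combination (-1) ^ m * hzero + (ε : ZMod p) * 2 ^ m * hw
  have h20 : (2 : ZMod p) ≠ 0 := Ring.two_ne_zero (by rw [ZMod.ringChar_zmod_n]; lia)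
  have h4 : (2 : ZMod p) ^ m * 2 ^ m = 1 := by
    rw [← pow_add, show m + m = p - 1 by lia, ZMod.pow_card_sub_one_eq_one h20]
  rw [h22, ← h2, mul_assoc, h4, mul_one]

/-- `∏ (ζ ^ a - ζ ^ (-a))` over `1 ≤ a ≤ (p-1)/2` squares to `(-1)^((p-1)/2) * p`. -/
theorem prod_pow_sub_pow_sq {p m : ℕ} (hm : p = 2 * m + 1) {ζ : ℂ} (hζ : IsPrimitiveRoot ζ p) :
    (∏ a ∈ Finset.range m, (ζ ^ (a + 1) - ζ ^ (p - (a + 1)))) ^ 2 = (-1) ^ m * p := by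
  have hζ2 : IsPrimitiveRoot (ζ ^ 2) (m + m + 1) := by
    rw [← two_mul, ← hm]
    exact hζ.pow_of_coprime 2 (by rw [Nat.coprime_two_left, hm]; exact odd_two_mul_add_one m)
  have h := hζ2.prod_one_sub_pow_eq_order
  have hcast : ((m + m : ℕ) : ℂ) + 1 = p := by rw [hm]; push_cast; ring
  rw [hcast, Finset.prod_range_add, ← Finset.prod_range_reflect (fun x ↦ 1 - (ζ ^ 2) ^ (m + x + 1)),
    ← Finset.prod_mul_distrib] at h
  have hneg : (-1 : ℂ) ^ m = ∏ a ∈ Finset.range m, (-1 : ℂ) := by simp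
  rw [← h, ← Finset.prod_pow, hneg, ← Finset.prod_mul_distrib]
  refine Finset.prod_congr rfl fun a ha ↦ ?_
  have ha' := Finset.mem_range.mp ha
  have h1 : ζ ^ (a + 1) * ζ ^ (p - (a + 1)) = 1 := by
    rw [← pow_add, Nat.add_sub_cancel' (by lia), hζ.pow_eq_one]
  rw [show m + (m - 1 - a) + 1 = p - (a + 1) by lia, ← pow_mul, ← pow_mul, mul_comm 2, mul_comm 2,
    pow_mul, pow_mul]
  generalize ζ ^ (a + 1) = u at *
  generalize ζ ^ (p - (a + 1)) = v at *
  linear_combination (u * v - 1) * h1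

theorem exists_prod_pow_sub_pow_eq (p m : ℕ) [Fact p.Prime] (hm : p = 2 * m + 1) :
    ∃ r : ℝ, 0 < r ∧ ∏ a ∈ Finset.range m,
      (ZMod.stdAddChar (1 : ZMod p) ^ (a + 1) - ZMod.stdAddChar (1 : ZMod p) ^ (p - (a + 1)))
      = Complex.I ^ m * r := by
  refine ⟨∏ a ∈ Finset.range m, 2 * Real.sin (2 * Real.pi * (a + 1) / p),
    Finset.prod_pos fun a ha ↦ ?_, ?_⟩
  · have ha' := Finset.mem_range.mp ha
    have hp0 : (0 : ℝ) < p := by rw [hm]; positivity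
    refine mul_pos two_pos (Real.sin_pos_of_pos_of_lt_pi (by positivity) ?_)
    rw [div_lt_iff₀ hp0, mul_comm 2, mul_assoc]
    refine mul_lt_mul_of_pos_left ?_ Real.pi_pos
    exact_mod_cast (by lia : 2 * (a + 1) < p)
  · have hI : Complex.I ^ m = ∏ a ∈ Finset.range m, Complex.I := by simp
    rw [hI, Complex.ofReal_prod, ← Finset.prod_mul_distrib]
    refine Finset.prod_congr rfl fun a ha ↦ ?_
    have ha' := Finset.mem_range.mp ha
    have h1 : ∀ j : ℤ, ZMod.stdAddChar (j : ZMod p) =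
        Complex.exp ((2 * Real.pi * j / p : ℝ) * Complex.I) := fun j ↦ by
      rw [ZMod.stdAddChar_coe]
      congr 1
      push_cast
      ring
    have h2 : ZMod.stdAddChar (1 : ZMod p) ^ (a + 1) =
        Complex.exp ((2 * Real.pi * (a + 1) / p : ℝ) * Complex.I) := by
      rw [← AddChar.map_nsmul_eq_pow, nsmul_one]
      simpa using h1 (a + 1)
    have h3 : ZMod.stdAddChar (1 : ZMod p) ^ (p - (a + 1)) =
        Complex.exp ((-(2 * Real.pi * (a + 1) / p) : ℝ) * Complex.I) := by
      rw [← AddChar.map_nsmul_eq_pow, nsmul_one, Nat.cast_sub (by lia), CharP.cast_eq_zero,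
        zero_sub]
      have := h1 (-(a + 1))
      push_cast at this ⊢
      rw [this]
      congr 1
      ring
    rw [h2, h3, Complex.exp_mul_I, Complex.exp_mul_I, ← Complex.ofReal_cos, ← Complex.ofReal_cos,
      ← Complex.ofReal_sin, ← Complex.ofReal_sin, Real.cos_neg, Real.sin_neg]
    push_cast
    ring

theorem complexQuadraticChar_zmod_neg_one (p m : ℕ) [Fact p.Prime] (hm : p = 2 * m + 1) :
    complexQuadraticChar (ZMod p) (-1) = (-1) ^ m := by
  have hF : ringChar (ZMod p) ≠ 2 := by rw [ZMod.ringChar_zmod_n]; lia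
  rw [complexQuadraticChar, MulChar.ringHomComp_apply, quadraticChar_neg_one hF, ZMod.card,
    ZMod.χ₄_eq_neg_one_pow (by lia), show p / 2 = m by lia]
  simp

theorem stdAddChar_ne_one (p : ℕ) [Fact p.Prime] :
    (ZMod.stdAddChar : AddChar (ZMod p) ℂ) ≠ 1 := fun h ↦ by
  have h1 := isPrimitiveRoot_stdAddChar_one p
  rw [h, AddChar.one_apply, IsPrimitiveRoot.one_left_iff] at h1
  exact (Fact.out : p.Prime).ne_one h1

/-- Gauss's determination of the sign of the quadratic Gauss sum modulo a prime. -/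
theorem sum_stdAddChar_sq (p : ℕ) [Fact p.Prime] (hp : Odd p) :
    ∑ y : ZMod p, ZMod.stdAddChar (y ^ 2) =
      (if p % 4 = 1 then 1 else Complex.I) * (Real.sqrt p : ℂ) := by
  obtain ⟨m, hm⟩ := hp
  have hF : ringChar (ZMod p) ≠ 2 := by rw [ZMod.ringChar_zmod_n]; lia
  obtain ⟨r, hr0, hr⟩ := exists_prod_pow_sub_pow_eq p m hm
  have hQ := prod_pow_sub_pow_sq hm (isPrimitiveRoot_stdAddChar_one p)
  have hG : (∑ y : ZMod p, ZMod.stdAddChar (y ^ 2)) ^ 2 = (-1) ^ m * (p : ℂ) := by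
    rw [sum_addChar_sq hF (stdAddChar_ne_one p),
      gaussSum_sq (complexQuadraticChar_ne_one hF) (isQuadratic_complexQuadraticChar _)
        (ZMod.isPrimitive_stdAddChar p), complexQuadraticChar_zmod_neg_one p m hm, ZMod.card]
  have hrp : r = Real.sqrt p := by
    rw [eq_comm, Real.sqrt_eq_iff_mul_self_eq_of_pos hr0]
    rw [hr, mul_pow, ← pow_mul, mul_comm m, pow_mul, Complex.I_sq] at hQ
    have := mul_left_cancel₀ (pow_ne_zero m (neg_ne_zero.mpr one_ne_zero)) hQ
    rw [← sq]
    exact_mod_cast this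
  obtain ⟨ε, hε1, hε⟩ : ∃ ε : ℤ, (ε = 1 ∨ ε = -1) ∧
      ∑ y : ZMod p, ZMod.stdAddChar (y ^ 2) = ε * ∏ a ∈ Finset.range m,
      (ZMod.stdAddChar (1 : ZMod p) ^ (a + 1) - ZMod.stdAddChar (1 : ZMod p) ^ (p - (a + 1))) := by
    rcases sq_eq_sq_iff_eq_or_eq_neg.mp (hG.trans hQ.symm) with h | h
    · exact ⟨1, Or.inl rfl, by simpa using h⟩
    · exact ⟨-1, Or.inr rfl, by simpa using h⟩
  have hmod := sign_eq_neg_two_pow p m hm ε hε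
  have h20 : (-2 : ZMod p) ≠ 0 := neg_ne_zero.mpr (Ring.two_ne_zero hF)
  have hp2 : p ≠ 2 := by lia
  have h11 : (-1 : ZMod p) ≠ 1 := Ring.neg_one_ne_one_of_char_ne_two hF
  have heuler := ZMod.euler_criterion p h20
  rw [ZMod.exists_sq_eq_neg_two_iff hp2, show p / 2 = m by lia, ← hmod] at heuler
  rw [hε, hr, hrp, ← mul_assoc]
  congr 1
  rcases hε1 with rfl | rfl
  · rw [Int.cast_one, one_mul]
    have h8 := heuler.mpr (by simp)
    rcases h8 with h8 | h8
    · rw [if_pos (by lia), show m = 4 * (m / 4) by lia, pow_mul, Complex.I_pow_four, one_pow]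
    · rw [if_neg (by lia), show m = 4 * (m / 4) + 1 by lia, pow_add, pow_mul, Complex.I_pow_four,
        one_pow, one_mul, pow_one]
  · have h8 : ¬ (p % 8 = 1 ∨ p % 8 = 3) := fun h ↦ h11 (by simpa using heuler.mp h)
    push Not at h8
    rcases (by lia : p % 8 = 5 ∨ p % 8 = 7) with h | h
    · rw [if_pos (by lia), show m = 4 * (m / 4) + 2 by lia, pow_add, pow_mul, Complex.I_pow_four,
        Complex.I_sq]
      simp
    · rw [if_neg (by lia), show m = 4 * (m / 4) + 3 by lia, pow_add, pow_mul, Complex.I_pow_four,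
        Complex.I_pow_three]
      simp

/-- The additive character of a finite extension of `ZMod p` obtained from the standard one by
composition with the trace. -/
noncomputable def traceAddChar (p : ℕ) [Fact p.Prime] (F : Type*) [Field F] [Algebra (ZMod p) F] :
    AddChar F ℂ :=
  (ZMod.stdAddChar (N := p)).compAddMonoidHom (Algebra.trace (ZMod p) F).toAddMonoidHom

theorem traceAddChar_apply (p : ℕ) [Fact p.Prime] (F : Type*) [Field F] [Algebra (ZMod p) F]
    (x : F) : traceAddChar p F x = ZMod.stdAddChar (Algebra.trace (ZMod p) F x) :=
  rfl

theorem traceAddChar_ne_one (p : ℕ) [Fact p.Prime] (F : Type*) [Field F] [Finite F]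
    [Algebra (ZMod p) F] : traceAddChar p F ≠ 1 := fun h ↦ by
  refine stdAddChar_ne_one p (DFunLike.ext _ _ fun y ↦ ?_)
  obtain ⟨x, rfl⟩ := Algebra.trace_surjective (ZMod p) F y
  rw [← traceAddChar_apply, h, AddChar.one_apply, AddChar.one_apply]

theorem complexQuadraticChar_zmod_eq_neg_one_pow {p : ℕ} [Fact p.Prime] (hp : Odd p) {d : ZMod p}
    {k : ℕ} (hd : d ^ (p / 2) = (-1) ^ k) : complexQuadraticChar (ZMod p) d = (-1) ^ k := by
  have hF : ringChar (ZMod p) ≠ 2 := by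
    rw [ZMod.ringChar_zmod_n]; rintro rfl; exact absurd hp (by decide)
  have h11 : (-1 : ZMod p) ≠ 1 := Ring.neg_one_ne_one_of_char_ne_two hF
  have hd0 : d ≠ 0 := by
    rintro rfl
    rw [zero_pow (Nat.div_pos (Fact.out : p.Prime).two_le two_pos).ne'] at hd
    exact pow_ne_zero k (neg_ne_zero.mpr one_ne_zero) hd.symm
  have h := quadraticChar_eq_pow_of_char_ne_two' hF d
  rw [ZMod.card, hd] at h
  rw [complexQuadraticChar, MulChar.ringHomComp_apply]
  rcases quadraticChar_dichotomy hd0 with h1 | h1 <;>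
  rcases neg_one_pow_eq_or (ZMod p) k with h2 | h2 <;>
  rcases Nat.even_or_odd k with h3 | h3 <;>
  simp_all [h3.neg_one_pow, eq_comm]

theorem addChar_map_sum {A M ι : Type*} [AddCommMonoid A] [CommMonoid M] (φ : AddChar A M)
    (t : Finset ι) (f : ι → A) : φ (∑ i ∈ t, f i) = ∏ i ∈ t, φ (f i) :=
  map_prod φ.toMonoidHom (fun i ↦ Multiplicative.ofAdd (f i)) t

theorem trace_sum_smul_sq {K L ι : Type*} [CommRing K] [CommRing L] [Algebra K L] [Fintype ι]
    {b : ι → L} (hb : ∀ i j, i ≠ j → Algebra.trace K L (b i * b j) = 0) (v : ι → K) :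
    Algebra.trace K L ((∑ i, v i • b i) ^ 2) = ∑ i, Algebra.trace K L (b i * b i) * v i ^ 2 := by
  rw [sq, Finset.sum_mul_sum, map_sum]
  refine Finset.sum_congr rfl fun i _ ↦ ?_
  rw [map_sum, Finset.sum_eq_single i]
  · rw [smul_mul_smul_comm, map_smul, smul_eq_mul]
    ring
  · intro j _ hj
    rw [smul_mul_smul_comm, map_smul, hb i j hj.symm, smul_zero]
  · simp

theorem discr_eq_prod_trace_mul_self {K L ι : Type*} [CommRing K] [CommRing L] [Algebra K L]
    [Fintype ι] [DecidableEq ι] {b : ι → L}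
    (hb : ∀ i j, i ≠ j → Algebra.trace K L (b i * b j) = 0) :
    Algebra.discr K b = ∏ i, Algebra.trace K L (b i * b i) := by
  rw [Algebra.discr_def, ← Matrix.det_diagonal]
  congr 1
  ext i j
  rw [Algebra.traceMatrix_apply, Algebra.traceForm_apply, Matrix.diagonal_apply]
  split_ifs with hij
  · rw [← hij]
  · exact hb i j hij

theorem exists_basis_trace_mul_eq_zero (K L : Type*) [Field K] [Field L] [Algebra K L]
    [FiniteDimensional K L] (hK : (2 : K) ≠ 0) :
    ∃ b : Module.Basis (Fin (Module.finrank K L)) K L,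
      ∀ i j, i ≠ j → Algebra.trace K L (b i * b j) = 0 := by
  let : Invertible (2 : K) := invertibleOfNonzero hK
  obtain ⟨b, hb⟩ := LinearMap.BilinForm.exists_orthogonal_basis
    (LinearMap.BilinForm.isSymm_iff.mp (Algebra.traceForm_isSymm K (S := L)))
  exact ⟨b, fun i j hij ↦ by
    simpa only [Function.onFun, Algebra.traceForm_apply] using hb hij⟩

/-- The quadratic Gauss sum of a finite field of characteristic `p` in terms of that of `ZMod p`. -/
theorem sum_traceAddChar_sq {p : ℕ} [Fact p.Prime] (hp : Odd p) (F : Type*) [Field F] [Fintype F]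
    [Algebra (ZMod p) F] :
    ∑ x : F, traceAddChar p F (x ^ 2) = (-1) ^ (Module.finrank (ZMod p) F - 1) *
      (∑ y : ZMod p, ZMod.stdAddChar (y ^ 2)) ^ Module.finrank (ZMod p) F := by
  have hF : ringChar (ZMod p) ≠ 2 := by
    rw [ZMod.ringChar_zmod_n]; rintro rfl; exact absurd hp (by decide)
  obtain ⟨b, hb⟩ := exists_basis_trace_mul_eq_zero (ZMod p) F (Ring.two_ne_zero hF)
  have hdiscr := discr_eq_prod_trace_mul_self hb
  have ha0 : ∀ i, Algebra.trace (ZMod p) F (b i * b i) ≠ 0 := fun i h ↦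
    Algebra.discr_not_zero_of_basis (ZMod p) b
      (hdiscr.trans (Finset.prod_eq_zero (Finset.mem_univ i) h))
  have hχ : complexQuadraticChar (ZMod p) (Algebra.discr (ZMod p) b) =
    (-1) ^ (Module.finrank (ZMod p) F - 1) :=
    complexQuadraticChar_zmod_eq_neg_one_pow hp (by
      have h := discr_pow_card_div_two (by rwa [ZMod.card]) b
      rwa [ZMod.card] at h)
  calc ∑ x : F, traceAddChar p F (x ^ 2)
      = ∑ v : Fin (Module.finrank (ZMod p) F) → ZMod p,
          ∏ i, ZMod.stdAddChar (Algebra.trace (ZMod p) F (b i * b i) * v i ^ 2) := by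
        rw [← Equiv.sum_comp b.equivFun.symm.toEquiv]
        refine Finset.sum_congr rfl fun v _ ↦ ?_
        rw [traceAddChar_apply, LinearEquiv.coe_toEquiv, b.equivFun_symm_apply,
          trace_sum_smul_sq hb, addChar_map_sum]
    _ = ∏ i, ∑ y : ZMod p, ZMod.stdAddChar (Algebra.trace (ZMod p) F (b i * b i) * y ^ 2) :=
        by rw [Fintype.prod_sum]
    _ = ∏ i, (complexQuadraticChar (ZMod p) (Algebra.trace (ZMod p) F (b i * b i)) *
          ∑ y : ZMod p, ZMod.stdAddChar (y ^ 2)) :=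
        Finset.prod_congr rfl fun i _ ↦ by
          rw [sum_addChar_mul_sq hF (stdAddChar_ne_one p) (ha0 i),
            sum_addChar_sq hF (stdAddChar_ne_one p)]
    _ = _ := by
        rw [Finset.prod_mul_distrib, ← map_prod, ← hdiscr, hχ, Finset.prod_const,
          Finset.card_univ, Fintype.card_fin]

/-- If `c` does not lie in the base field, then `x ↦ (Tr x, Tr (c x))` is surjective. -/
theorem trace_prod_trace_mul_surjective {K L : Type*} [Field K] [Field L] [Algebra K L]
    [FiniteDimensional K L] [Algebra.IsSeparable K L] {c : L}
    (hc : c ∉ Set.range (algebraMap K L)) :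
    Function.Surjective
      ((Algebra.trace K L).prod (Algebra.trace K L ∘ₗ LinearMap.mulLeft K c)) := by
  rw [← LinearMap.range_eq_top]
  by_contra hne
  obtain ⟨f, hf0, hf⟩ := Submodule.exists_le_ker_of_lt_top _ (lt_top_iff_ne_top.mpr hne)
  set α := f (1, 0) with hα
  set β := f (0, 1) with hβ
  have hfab : ∀ u v, f (u, v) = α * u + β * v := fun u v ↦ by
    have : ((u, v) : K × K) = u • (1, 0) + v • (0, 1) := by simp
    rw [this, map_add, map_smul, map_smul, smul_eq_mul, smul_eq_mul, mul_comm u, mul_comm v]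
  have hzero : algebraMap K L α + algebraMap K L β * c = 0 := by
    refine (traceForm_nondegenerate K L).1 _ fun x ↦ ?_
    have := hf (LinearMap.mem_range_self _ x)
    rw [LinearMap.mem_ker, LinearMap.prod_apply, Function.prod_apply, hfab] at this
    rw [Algebra.traceForm_apply, add_mul, mul_assoc, ← Algebra.smul_def, ← Algebra.smul_def,
      map_add, map_smul, map_smul]
    simpa using this
  have hβ0 : β = 0 := by
    by_contra h
    have h' : algebraMap K L β ≠ 0 := by simpa using h
    refine hc ⟨-α / β, ?_⟩
    rw [map_div₀, map_neg, div_eq_iff h']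
    linear_combination -hzero
  have hα0 : α = 0 := by simpa [hβ0] using hzero
  exact hf0 (LinearMap.ext fun ⟨u, v⟩ ↦ by simp [hfab, hα0, hβ0])

theorem psiC_eq_traceAddChar (p : ℕ) [Fact p.Prime] (F : Type) [Field F] [Fintype F] [CharP F p]
    [inst : Algebra (ZMod p) F] (x : F) : psiC p F x = traceAddChar p F x := by
  have hinst : inst = ZMod.algebra F p := Subsingleton.elim _ _
  have h := ZMod.stdAddChar_coe (N := p) ((Algebra.trace (ZMod p) F x).val : ℤ)
  rw [Int.cast_natCast, ZMod.natCast_zmod_val, Int.cast_natCast] at h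
  rw [traceAddChar_apply, h, psiC]
  subst hinst
  rfl

theorem quad_form_char_sum (p s n : ℕ) [Fact p.Prime] (hp : Odd p) (hs : 0 < s) (hn : 0 < n)
    (q : ℕ) (hq : q = p ^ s)
    (Fq Fqn : Type) [Field Fq] [Field Fqn] [Fintype Fq] [Fintype Fqn] [Algebra Fq Fqn]
    [CharP Fqn p]
    (hcard : Fintype.card Fq = q) (hcardn : Fintype.card Fqn = q ^ n)
    (η₂ : MulChar Fq ℂ) (hη : orderOf η₂ = 2) :
    (∀ c₀ : Fq, c₀ ≠ 0 →
      ∑ x : Fqn, psiC p Fqn (algebraMap Fq Fqn c₀ * x *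
          algebraMap Fq Fqn (Algebra.trace Fq Fqn x))
        = (-1) ^ (s + 1) * η₂ c₀ * tauC p ^ s * (q : ℂ) ^ (n - 1) * Real.sqrt q) ∧
    (∀ c : Fqn, c ∉ Set.range (algebraMap Fq Fqn) →
      ∑ x : Fqn, psiC p Fqn (c * x * algebraMap Fq Fqn (Algebra.trace Fq Fqn x))
        = (q : ℂ) ^ (n - 1)) := by
  classical
  have hchar : CharP Fq p := (algebraMap Fq Fqn).charP (algebraMap Fq Fqn).injective p
  let : Algebra (ZMod p) Fq := ZMod.algebra Fq p
  let : Algebra (ZMod p) Fqn := ZMod.algebra Fqn p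
  have : IsScalarTower (ZMod p) Fq Fqn := IsScalarTower.of_algebraMap_eq' (Subsingleton.elim _ _)
  have hFq : ringChar Fq ≠ 2 := by
    rw [ringChar.eq_iff.mpr hchar]
    rintro rfl
    exact absurd hp (by decide)
  have hfin : Module.finrank (ZMod p) Fq = s := by
    have h := Module.card_eq_pow_finrank (K := ZMod p) (V := Fq)
    rw [hcard, hq, ZMod.card] at h
    exact (Nat.pow_right_injective (Fact.out : p.Prime).two_le h).symm
  have hq0 : (q : ℂ) ≠ 0 := by
    rw [hq]
    exact_mod_cast pow_ne_zero s (Fact.out : p.Prime).ne_zero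
  have hqn : (q : ℂ) ^ n = q * q ^ (n - 1) := by rw [← pow_succ', Nat.sub_add_cancel hn]
  have hred : ∀ c x : Fqn, psiC p Fqn (c * x * algebraMap Fq Fqn (Algebra.trace Fq Fqn x)) =
      traceAddChar p Fq (Algebra.trace Fq Fqn x * Algebra.trace Fq Fqn (c * x)) := fun c x ↦ by
    rw [psiC_eq_traceAddChar, traceAddChar_apply, traceAddChar_apply,
      ← Algebra.trace_trace (S := Fq), mul_comm (c * x), ← Algebra.smul_def, map_smul, smul_eq_mul]
  refine ⟨fun c₀ hc₀ ↦ ?_, fun c hc ↦ ?_⟩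
  · apply mul_left_cancel₀ hq0
    have hsum := card_mul_sum_comp_of_surjective (Algebra.trace Fq Fqn).toAddMonoidHom
      (Algebra.trace_surjective Fq Fqn) (fun t ↦ traceAddChar p Fq (c₀ * t ^ 2))
    rw [hcard, hcardn, sum_addChar_mul_sq hFq (traceAddChar_ne_one p Fq) hc₀,
      ← sum_addChar_sq hFq (traceAddChar_ne_one p Fq), sum_traceAddChar_sq hp, hfin,
      sum_stdAddChar_sq p hp, ← eq_complexQuadraticChar_of_orderOf_eq_two hFq hη] at hsum
    have hsqrt : (Real.sqrt q : ℂ) = (Real.sqrt p : ℂ) ^ s := by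
      rw [hq, Nat.cast_pow, Real.sqrt_eq_rpow, ← Real.rpow_natCast_mul (by positivity), mul_comm,
        Real.rpow_mul_natCast (by positivity), ← Real.sqrt_eq_rpow, Complex.ofReal_pow]
    have hsign : (-1 : ℂ) ^ (s + 1) = (-1) ^ (s - 1) := by
      rw [show s + 1 = s - 1 + 2 by lia, pow_add]
      simp
    simp_rw [hred]
    convert! hsum using 1
    · congr 1
      refine Finset.sum_congr rfl fun x _ ↦ ?_
      rw [← Algebra.smul_def, map_smul, smul_eq_mul]
      congr 1
      simp only [LinearMap.toAddMonoidHom_coe]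
      ring
    · rw [hsqrt, hsign, Nat.cast_pow, hqn, mul_pow, tauC]
      ring
  · have hsum := card_mul_sum_comp_of_surjective
      ((Algebra.trace Fq Fqn).prod (Algebra.trace Fq Fqn ∘ₗ LinearMap.mulLeft Fq c)).toAddMonoidHom
      (trace_prod_trace_mul_surjective hc) (fun t ↦ traceAddChar p Fq (t.1 * t.2))
    have hpair : ∑ t : Fq × Fq, traceAddChar p Fq (t.1 * t.2) = q := by
      rw [Fintype.sum_prod_type, Finset.sum_comm]
      simp_rw [AddChar.sum_mulShift _ (AddChar.IsPrimitive.of_ne_one (traceAddChar_ne_one p Fq))]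
      simp [hcard]
    rw [hpair, Fintype.card_prod, hcard, hcardn, Nat.cast_mul, Nat.cast_pow, hqn] at hsum
    simp_rw [hred]
    apply mul_left_cancel₀ (mul_ne_zero hq0 hq0)
    refine Eq.trans ?_ (hsum.trans (by ring))
    rfl
end

section
/- Let q = p^s with p an odd prime, n even, χ₂ the quadratic character of F_{q^n}*, a ∈ F_{q^n}*, b ∈ F_{q^n} with Tr(b/a) = 0, and τ = 1 if p ≡ 1 (mod 4), τ = i if p ≡ 3 (mod 4). Then the number of F_{q^n}-points on y² = a·x·Tr(x) + b equals q^n + q^{n−1}χ₂(b) + τ^{ns}·χ₂(−a)·(q−1)·q^{(n−2)/2}. -/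
/-- The number of `F_{q^n}`-rational points on the affine curve `y^d = a·x·Tr(x) + b`. -/
noncomputable def curveCard (Fq Fqn : Type) [Field Fq] [Field Fqn] [Fintype Fq] [Fintype Fqn]
    [Algebra Fq Fqn] (d : ℕ) (a b : Fqn) : ℕ :=
  Nat.card {xy : Fqn × Fqn //
    xy.2 ^ d = a * xy.1 * algebraMap Fq Fqn (Algebra.trace Fq Fqn xy.1) + b}

/-- The value of a Gauss sum over a quadratic extension `L / K` when the multiplicative character
is trivial on `Kˣ` and the additive character is trivial on the line `K δ`. -/
lemma gaussSum_of_subfield {L : Type*} [Field L] [Fintype L] (K : Subfield L)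
    (hK : Nat.card L = Nat.card K ^ 2) (χ : MulChar L ℂ) (hχ : χ ≠ 1)
    (hχK : ∀ c ∈ K, c ≠ 0 → χ c = 1) (ψ : AddChar L ℂ) (hψ : ψ ≠ 1)
    (δ : L) (hδ : δ ≠ 0) (hψδ : ∀ c ∈ K, ψ (c * δ) = 1) :
    gaussSum χ ψ = Nat.card K * χ δ := by
  classical
  have hprim := AddChar.IsPrimitive.of_ne_one hψ
  have hK1 : 1 < Nat.card K := by
    rw [Nat.card_eq_fintype_card]; exact Fintype.one_lt_card
  set U : Finset L := {u | ∀ c ∈ K, ψ (c * u) = 1} with hU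
  have inner (u : L) : ∑ c : K, ψ (c * u) = if u ∈ U then (Nat.card K : ℂ) else 0 := by
    have h := AddChar.sum_eq_ite
      ((ψ.compAddMonoidHom (AddMonoidHom.mulRight u)).compAddMonoidHom K.subtype.toAddMonoidHom)
    rw [Nat.card_eq_fintype_card]
    refine Eq.trans (Eq.trans ?_ h) (if_congr ?_ rfl rfl)
    · rfl
    symm
    rw [hU, Finset.mem_filter_univ]
    constructor
    · intro hu
      ext c
      exact hu c c.2
    · intro h0 c hc
      exact DFunLike.congr_fun h0 (⟨c, hc⟩ : K)
  have hcardU : (U.card : ℂ) = Nat.card K := by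
    have h1 : ∑ u : L, ∑ c : K, ψ (c * u) = Nat.card K * U.card := by
      simp_rw [inner]
      simp [mul_comm]
    have h2 : ∑ u : L, ∑ c : K, ψ (c * u) = Nat.card L := by
      rw [Finset.sum_comm]
      simp_rw [mul_comm _ (_ : L), AddChar.sum_mulShift _ hprim]
      simp [Nat.card_eq_fintype_card]
    rw [h1, hK] at h2
    have : (Nat.card K : ℂ) ≠ 0 := by norm_cast; omega
    push_cast at h2
    rw [sq] at h2
    exact mul_left_cancel₀ this h2
  have hUimg : U = Finset.univ.image (fun c : K ↦ (c : L) * δ) := by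
    symm
    apply Finset.eq_of_subset_of_card_le
    · intro x hx
      obtain ⟨c, -, rfl⟩ := Finset.mem_image.mp hx
      rw [hU, Finset.mem_filter_univ]
      intro d hd
      rw [← mul_assoc]
      exact hψδ _ (K.mul_mem hd c.2)
    · rw [Finset.card_image_of_injective _
        (fun c d h ↦ Subtype.ext (mul_right_cancel₀ hδ h)), Finset.card_univ,
        ← Nat.card_eq_fintype_card]
      exact le_of_eq (by exact_mod_cast hcardU)
  have hχc (c : K) : χ (c : L) = if c = 0 then 0 else 1 := by
    split_ifs with h
    · simp [h, MulChar.map_zero χ]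
    · exact hχK c c.2 (by simpa using h)
  have hcount : ∑ c : K, χ (c : L) = Nat.card K - 1 := by
    simp_rw [hχc]
    rw [← Finset.sum_erase_add _ _ (Finset.mem_univ (0 : K)),
      Finset.sum_congr rfl fun x hx ↦ if_neg (Finset.ne_of_mem_erase hx)]
    simp [Nat.card_eq_fintype_card, Fintype.card_pos]
  have e1 : ∑ u : L, χ u * ∑ c : K, ψ (c * u) = Nat.card K * ((Nat.card K - 1) * χ δ) := by
    simp_rw [inner, mul_ite, mul_zero, Finset.sum_ite_mem, Finset.univ_inter, ← Finset.sum_mul]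
    rw [hUimg, Finset.sum_image (fun c _ d _ h ↦ Subtype.ext (mul_right_cancel₀ hδ h))]
    simp_rw [map_mul, ← Finset.sum_mul, hcount]
    ring
  have e2 : ∑ u : L, χ u * ∑ c : K, ψ (c * u) = (Nat.card K - 1) * gaussSum χ ψ := by
    simp_rw [Finset.mul_sum]
    rw [Finset.sum_comm, ← hcount, Finset.sum_mul]
    refine Finset.sum_congr rfl fun c _ ↦ ?_
    by_cases hc : c = 0
    · simp [hc, MulChar.map_zero χ, MulChar.sum_eq_zero_of_ne_one hχ]
    · have hc' : (c : L) ≠ 0 := by simpa using hc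
      have h := gaussSum_mulShift χ ψ (Units.mk0 (c : L) hc')
      rw [Units.val_mk0, hχK c c.2 hc', one_mul] at h
      rw [hχK c c.2 hc', one_mul, ← h]
      simp [gaussSum]
  have hne : (Nat.card K : ℂ) - 1 ≠ 0 := by
    rw [sub_ne_zero]; norm_cast; omega
  apply mul_left_cancel₀ hne
  rw [← e2, e1]
  ring

/-- The sum of a nontrivial multiplicative character over the kernel of the trace, in terms of a
Gauss sum. -/
lemma card_mul_sum_ker_trace {F L : Type*} [Field F] [Field L] [Fintype F] [Fintype L]
    [DecidableEq F] [Algebra F L] (χ : MulChar L ℂ) (hχ : χ ≠ 1)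
    (hχF : ∀ c : F, c ≠ 0 → χ (algebraMap F L c) = 1) (ψ : AddChar F ℂ) (hψ : ψ.IsPrimitive) :
    (Fintype.card F : ℂ) * ∑ u : L with Algebra.trace F L u = 0, χ u
      = (Fintype.card F - 1) *
        gaussSum χ (ψ.compAddMonoidHom (Algebra.trace F L).toAddMonoidHom) := by
  have e1 : ∑ u : L, χ u * ∑ c : F, ψ (c * Algebra.trace F L u)
      = Fintype.card F * ∑ u : L with Algebra.trace F L u = 0, χ u := by
    simp_rw [AddChar.sum_mulShift _ hψ, Finset.sum_filter, Finset.mul_sum]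
    refine Finset.sum_congr rfl fun u _ ↦ ?_
    split_ifs <;> simp [mul_comm]
  rw [← e1]
  simp_rw [Finset.mul_sum]
  rw [Finset.sum_comm, ← Finset.sum_erase_add _ _ (Finset.mem_univ (0 : F))]
  simp only [zero_mul, AddChar.map_zero_eq_one, mul_one, MulChar.sum_eq_zero_of_ne_one hχ, add_zero]
  rw [Finset.sum_congr rfl (g := fun _ ↦ gaussSum χ
    (ψ.compAddMonoidHom (Algebra.trace F L).toAddMonoidHom))]
  · simp [Nat.cast_sub Fintype.card_pos]
  · intro c hc
    have hc0 := Finset.ne_of_mem_erase hc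
    have hc' : algebraMap F L c ≠ 0 := by simpa using hc0
    rw [← gaussSum_mulShift _ _ (Units.mk0 _ hc'), Units.val_mk0, hχF c hc0, one_mul, gaussSum]
    simp [← Algebra.smul_def]

/-- A complex character of order two of a finite field is the quadratic character. -/
lemma MulChar.eq_quadraticChar_of_orderOf_eq_two {L : Type*} [Field L] [Fintype L] [DecidableEq L]
    (χ : MulChar L ℂ) (hχ : orderOf χ = 2) (x : L) : χ x = quadraticChar L x := by
  have hχ1 : χ ≠ 1 := by
    rintro rfl
    simp at hχ
  have hsq (y : L) (hy : y ≠ 0) : χ y * χ y = 1 := by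
    have h : (χ ^ 2) y = (1 : MulChar L ℂ) y := by rw [← hχ, pow_orderOf_eq_one]
    rw [MulChar.one_apply hy.isUnit, sq] at h
    exact h
  obtain ⟨z, hz⟩ := MulChar.ne_one_iff.mp hχ1
  have hz0 : (z : L) ≠ 0 := z.ne_zero
  have hz1 : χ z = -1 := (mul_self_eq_one_iff.mp (hsq z hz0)).resolve_left hz
  have hsquare (y : L) (hy : y ≠ 0) (h : quadraticChar L y = 1) : χ y = 1 := by
    obtain ⟨w, rfl⟩ := (quadraticChar_one_iff_isSquare hy).mp h
    rw [map_mul]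
    exact hsq w (by rintro rfl; simp at hy)
  have hzq : quadraticChar L z = -1 :=
    (quadraticChar_dichotomy hz0).resolve_left fun h ↦ hz (hsquare _ hz0 h)
  rcases eq_or_ne x 0 with rfl | hx
  · simp
  rcases quadraticChar_dichotomy hx with h | h
  · simp [h, hsquare x hx h]
  · have h2 := hsquare (x * z) (mul_ne_zero hx hz0) (by rw [map_mul, h, hzq]; norm_num)
    rw [map_mul, hz1] at h2
    rw [h]
    push_cast
    linear_combination -h2

/-- The fixed field of `x ↦ x ^ r` in a finite field with `r ^ 2` elements has `r` elements. -/
lemma card_eqLocusField_pow {L : Type*} [Field L] [Fintype L] {r : ℕ} (hL : Nat.card L = r ^ 2)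
    (φ : L →+* L) (hφ : ∀ x, φ x = x ^ r) : Nat.card (φ.eqLocusField (RingHom.id L)) = r := by
  have hr : 1 < r := by
    have : 1 < Nat.card L := Finite.one_lt_card
    by_contra! h
    interval_cases r <;> simp_all
  set K := φ.eqLocusField (RingHom.id L)
  have hmem (x : L) : x ∈ K ↔ x ^ r = x := by
    rw [RingHom.mem_eqLocusField, hφ, RingHom.id_apply]
  have hpow (x : Lˣ) : x ^ (r - 1) = 1 ↔ (x : L) ∈ K := by
    rw [hmem, ← Units.val_pow_eq_pow_val, Units.val_inj, ← mul_eq_right (b := x), ← pow_succ,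
      Nat.sub_add_cancel hr.le]
  have hbij : Nat.card Kˣ = Nat.card (powMonoidHom (r - 1) : Lˣ →* Lˣ).ker := by
    refine Nat.card_eq_of_bijective (fun u ↦ ⟨Units.map K.subtype u, ?_⟩) ⟨?_, ?_⟩
    · rw [MonoidHom.mem_ker, powMonoidHom_apply, hpow]
      exact (u : K).2
    · intro u v h
      exact Units.ext (Subtype.ext (congrArg Units.val (congrArg Subtype.val h)))
    · rintro ⟨x, hx⟩
      rw [MonoidHom.mem_ker, powMonoidHom_apply, hpow] at hx
      refine ⟨Units.mk0 ⟨x, hx⟩ fun h ↦ x.ne_zero (congrArg Subtype.val h), ?_⟩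
      exact Subtype.ext (Units.ext rfl)
  rw [IsCyclic.card_powMonoidHom_ker, Nat.card_units, Nat.card_units, hL,
    Nat.gcd_eq_right ⟨r + 1, by zify [hr.le, Nat.one_le_pow 2 r (by omega)]; ring⟩] at hbij
  have : 0 < Nat.card K := Nat.card_pos
  omega

/-- In a finite field with `r ^ 2` elements, `r` odd, some nonzero `δ` satisfies `δ ^ r = -δ`. -/
lemma exists_pow_eq_neg {L : Type*} [Field L] [Fintype L] {r : ℕ} (hL : Nat.card L = r ^ 2)
    (hr : Odd r) : ∃ δ : L, δ ≠ 0 ∧ δ ^ r = -δ := by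
  have hr1 : r ≠ 1 := by
    rintro rfl
    have : 1 < Nat.card L := Finite.one_lt_card
    omega
  obtain ⟨k, rfl⟩ := hr
  obtain ⟨g, hg⟩ := IsCyclic.exists_ofOrder_eq_natCard (α := Lˣ)
  rw [Nat.card_units, hL] at hg
  refine ⟨((g ^ (k + 1) : Lˣ) : L), Units.ne_zero _, ?_⟩
  have hord : orderOf g = 2 * (2 * k * (k + 1)) := by
    rw [hg]
    apply Nat.sub_eq_of_eq_add
    ring
  have hhalf : ((g : L) ^ (2 * k * (k + 1))) = -1 := by
    have h1 : ((g : L) ^ (2 * k * (k + 1))) ^ 2 = 1 := by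
      rw [← pow_mul, mul_comm, ← hord, ← Units.val_pow_eq_pow_val, pow_orderOf_eq_one, Units.val_one]
    refine (mul_self_eq_one_iff.mp (by rwa [← sq])).resolve_left ?_
    intro h
    have h2 : g ^ (2 * k * (k + 1)) = 1 := Units.ext (by simpa using h)
    have hpos : 0 < 2 * k * (k + 1) := by
      have : 0 < k := by omega
      positivity
    have := Nat.le_of_dvd hpos (orderOf_dvd_of_pow_eq_one h2)
    omega
  rw [Units.val_pow_eq_pow_val, ← pow_mul,
    show (k + 1) * (2 * k + 1) = 2 * k * (k + 1) + (k + 1) by ring, pow_add, hhalf, neg_one_mul]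

/-- The Gauss sum of the quadratic character of a finite field with `r ^ 2` elements, where
`r = |F| ^ m` and the additive character is lifted from `F`. -/
lemma gaussSum_quadratic_of_card_sq {F L : Type*} [Field F] [Field L] [Fintype F] [Fintype L]
    [DecidableEq L] [Algebra F L] {m r : ℕ} (hr : r = Fintype.card F ^ m) (hodd : Odd r)
    (hL : Nat.card L = r ^ 2) (hchar : ringChar L ≠ 2) (χ : MulChar L ℂ) (hχ1 : χ ≠ 1)
    (hχ : ∀ x, χ x = quadraticChar L x) (hfix : ∀ c : L, c ≠ 0 → c ^ r = c → χ c = 1)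
    (ψ : AddChar F ℂ) (hψ : ψ ≠ 1) :
    gaussSum χ (ψ.compAddMonoidHom (Algebra.trace F L).toAddMonoidHom)
      = r * (-1) ^ ((r + 1) / 2) := by
  obtain ⟨δ, hδ, hδr⟩ := exists_pow_eq_neg hL hodd
  set φ : L ≃ₐ[F] L := FiniteField.frobeniusAlgEquivOfAlgebraic F L ^ m with hφdef
  have hφ (x : L) : φ x = x ^ r := by
    rw [hφdef, AlgEquiv.coe_pow, FiniteField.coe_frobeniusAlgEquivOfAlgebraic_iterate, hr]
  have hcard := card_eqLocusField_pow hL (φ : L →+* L) hφ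
  have hmem (c : L) (hc : c ∈ (φ : L →+* L).eqLocusField (RingHom.id L)) : c ^ r = c := by
    rw [← hφ]; exact hc
  have hχδ : χ δ = (-1) ^ ((r + 1) / 2) := by
    rw [hχ]
    have h : (quadraticChar L δ : L) = (((-1) ^ ((r + 1) / 2) : ℤ) : L) := by
      rw [quadraticChar_eq_pow_of_char_ne_two' hchar, ← Nat.card_eq_fintype_card, hL]
      obtain ⟨k, rfl⟩ := hodd
      have h1 : (2 * k + 1) ^ 2 / 2 = 2 * k * (k + 1) := by
        rw [show (2 * k + 1) ^ 2 = 2 * (2 * k * (k + 1)) + 1 by ring]; omega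
      have h2 : (2 * k + 1 + 1) / 2 = k + 1 := by omega
      rw [pow_succ, neg_eq_neg_one_mul] at hδr
      rw [h1, h2, pow_mul, mul_right_cancel₀ hδ hδr]
      push_cast
      rfl
    have hneg : ((-1 : L)) ≠ 1 := Ring.neg_one_ne_one_of_char_ne_two hchar
    rcases quadraticChar_dichotomy hδ with h1 | h1 <;>
    rcases neg_one_pow_eq_or ℤ ((r + 1) / 2) with h2 | h2 <;>
    rw [h1, h2] at h <;> push_cast at h
    · rw [h1, ← Int.cast_one, ← h2]; push_cast; rfl
    · exact absurd h.symm hneg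
    · exact absurd h hneg
    · rw [h1, ← h2]; push_cast; rfl
  rw [← hχδ, ← hcard]
  refine gaussSum_of_subfield _ (by rw [hcard, hL]) χ hχ1
    (fun c hc hc0 ↦ hfix c hc0 (hmem c hc)) _ ?_ δ hδ ?_
  · obtain ⟨y, hy⟩ := AddChar.ne_one_iff.mp hψ
    obtain ⟨x, rfl⟩ := Algebra.trace_surjective F L y
    exact AddChar.ne_one_iff.mpr ⟨x, hy⟩
  · intro c hc
    have ht : Algebra.trace F L (c * δ) = 0 := by
      have h := Algebra.trace_eq_of_algEquiv φ (c * δ)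
      rw [hφ, mul_pow, hmem c hc, hδr, mul_neg, map_neg] at h
      have h2 : (2 : F) ≠ 0 := by
        apply Ring.two_ne_zero
        rwa [Algebra.ringChar_eq F L]
      have : (2 : F) * Algebra.trace F L (c * δ) = 0 := by linear_combination -h
      exact (mul_eq_zero.mp this).resolve_left h2
    simp [ht]

/-- The points of `y ^ 2 = a x Tr(x) + b` counted by means of the quadratic character. -/
lemma curveCard_two {F L : Type} [Field F] [Field L] [Fintype F] [Fintype L] [DecidableEq L]
    [Algebra F L] (hchar : ringChar L ≠ 2) (a b : L) :
    (curveCard F L 2 a b : ℤ) = ∑ x : L,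
      (quadraticChar L (a * x * algebraMap F L (Algebra.trace F L x) + b) + 1) := by
  rw [curveCard, Nat.card_eq_fintype_card, Fintype.card_subtype, Finset.card_filter,
    Fintype.sum_prod_type]
  push_cast
  refine Finset.sum_congr rfl fun x _ ↦ ?_
  rw [← quadraticChar_card_sqrts hchar]
  simp

/-- The kernel of the trace of `L / F` has index `|F|`. -/
lemma card_mul_card_ker_trace (F L : Type*) [Field F] [Field L] [Fintype F] [Fintype L]
    [DecidableEq F] [Algebra F L] :
    Fintype.card F * Finset.card {x : L | Algebra.trace F L x = 0} = Fintype.card L := by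
  have h := Submodule.card_eq_card_quotient_mul_card (LinearMap.ker (Algebra.trace F L))
  rw [Nat.card_congr ((Algebra.trace F L).quotKerEquivOfSurjective
    (Algebra.trace_surjective F L)).toEquiv, mul_comm] at h
  rw [← Nat.card_eq_fintype_card, ← Nat.card_eq_fintype_card (α := L), h,
    ← Fintype.card_subtype, ← Nat.card_eq_fintype_card]
  rfl

/-- If `χ` is trivial on `Fˣ` and `Tr(b / a) = 0`, the character sum of the polynomial
`a x Tr(x) + b` reduces to the sum over the kernel of the trace. -/
lemma sum_mulChar_mul_trace_add {F L : Type*} [Field F] [Field L] [Fintype F] [Fintype L]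
    [DecidableEq F] [Algebra F L] (χ : MulChar L ℂ) (hχ : χ ≠ 1)
    (hχF : ∀ c : F, c ≠ 0 → χ (algebraMap F L c) = 1) {a b : L} (ha : a ≠ 0)
    (hb : Algebra.trace F L (b / a) = 0) :
    ∑ x : L, χ (a * x * algebraMap F L (Algebra.trace F L x) + b)
      = Finset.card {x : L | Algebra.trace F L x = 0} * χ b
        - χ a * ∑ x : L with Algebra.trace F L x = 0, χ x := by
  have hshift (c : F) : Algebra.trace F L (b / a / algebraMap F L c) = 0 := by
    rw [div_eq_inv_mul, ← map_inv₀, ← Algebra.smul_def, map_smul, hb, smul_zero]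
  have hzero := MulChar.sum_eq_zero_of_ne_one hχ
  rw [← Finset.sum_filter_add_sum_filter_not _ (fun x ↦ Algebra.trace F L x = 0)] at hzero ⊢
  have hker : ∑ x : L with Algebra.trace F L x = 0,
      χ (a * x * algebraMap F L (Algebra.trace F L x) + b)
      = Finset.card {x : L | Algebra.trace F L x = 0} * χ b := by
    rw [← nsmul_eq_mul, ← Finset.sum_const]
    refine Finset.sum_congr rfl fun x hx ↦ ?_
    rw [(Finset.mem_filter.mp hx).2]
    simp
  have hcompl : ∑ x : L with ¬ Algebra.trace F L x = 0,
      χ (a * x * algebraMap F L (Algebra.trace F L x) + b)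
      = χ a * ∑ x : L with ¬ Algebra.trace F L x = 0, χ x := by
    rw [Finset.mul_sum]
    refine Finset.sum_nbij' (fun x ↦ x + b / a / algebraMap F L (Algebra.trace F L x))
      (fun x ↦ x - b / a / algebraMap F L (Algebra.trace F L x)) ?_ ?_ ?_ ?_ ?_
    · intro x hx
      simpa [hshift] using hx
    · intro x hx
      simpa [hshift] using hx
    · intro x _
      simp [hshift]
    · intro x _
      simp [hshift]
    · intro x hx
      have ht := (Finset.mem_filter.mp hx).2
      have ht' : algebraMap F L (Algebra.trace F L x) ≠ 0 := by simpa using ht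
      rw [← map_mul, ← mul_one (χ (a * _)), ← hχF _ ht, ← map_mul]
      congr 1
      field_simp
  rw [hker, hcompl]
  linear_combination χ a * hzero

/-- The fourth root of unity `τ ^ (2m)` in terms of `p ^ m`. -/
lemma tauC_pow_two_mul {p : ℕ} (hp : Odd p) (m : ℕ) :
    tauC p ^ (2 * m) = -(-1) ^ ((p ^ m + 1) / 2) := by
  rw [tauC]
  split_ifs with h
  · have hm : p ^ m % 4 = 1 := by simp [Nat.pow_mod, h]
    rw [Odd.neg_one_pow (by rw [Nat.odd_iff]; omega)]
    simp
  · have h3 : p % 4 = 3 := by rw [Nat.odd_iff] at hp; omega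
    rw [pow_mul, Complex.I_sq]
    rcases Nat.even_or_odd' m with ⟨k, rfl | rfl⟩
    · have hm : p ^ (2 * k) % 4 = 1 := by
        rw [pow_mul, Nat.pow_mod, Nat.pow_mod p, h3]
        simp
      rw [Odd.neg_one_pow (n := (_ + 1) / 2) (by rw [Nat.odd_iff]; omega)]
      simp
    · have hm : p ^ (2 * k + 1) % 4 = 3 := by
        rw [pow_succ, pow_mul, Nat.mul_mod, Nat.pow_mod, Nat.pow_mod p, h3]
        simp
      rw [Even.neg_one_pow (n := (_ + 1) / 2) (by rw [Nat.even_iff]; omega)]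
      rw [pow_succ, pow_mul]
      simp

theorem curve_d2_n_even_B_zero (p s n : ℕ) [Fact p.Prime] (hp : Odd p) (hs : 0 < s) (hn : 0 < n)
    (q : ℕ) (hq : q = p ^ s)
    (Fq Fqn : Type) [Field Fq] [Field Fqn] [Fintype Fq] [Fintype Fqn] [Algebra Fq Fqn]
    (hcard : Fintype.card Fq = q) (hcardn : Fintype.card Fqn = q ^ n)
    (a : Fqn) (ha : a ≠ 0) (b : Fqn)
    (χ₂ : MulChar Fqn ℂ) (hχ : orderOf χ₂ = 2)
    (hneven : Even n) (hB : Algebra.trace Fq Fqn (b / a) = 0) :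
    (curveCard Fq Fqn 2 a b : ℂ)
      = (q : ℂ) ^ n + (q : ℂ) ^ (n - 1) * χ₂ b
        + tauC p ^ (n * s) * χ₂ (-a) * ((q : ℂ) - 1) * (q : ℂ) ^ ((n - 2) / 2) := by
  classical
  have hqodd : Odd q := hq ▸ hp.pow
  obtain ⟨k, rfl⟩ : ∃ k, n = 2 * (k + 1) := by
    obtain ⟨j, rfl⟩ := hneven
    exact ⟨j - 1, by omega⟩
  set r := q ^ (k + 1) with hr
  have hrodd : Odd r := hqodd.pow
  have hL : Nat.card Fqn = r ^ 2 := by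
    rw [Nat.card_eq_fintype_card, hcardn, hr, ← pow_mul, mul_comm]
  have hchar : ringChar Fqn ≠ 2 := by
    intro h
    have h2 := FiniteField.even_card_iff_char_two.mp h
    rw [hcardn, ← Nat.even_iff, ← Nat.not_odd_iff_even] at h2
    exact h2 hqodd.pow
  have hχ1 : χ₂ ≠ 1 := by
    rintro rfl
    simp at hχ
  have hχq := χ₂.eq_quadraticChar_of_orderOf_eq_two hχ
  have hfix (c : Fqn) (hc : c ≠ 0) (hcr : c ^ r = c) : χ₂ c = 1 := by
    obtain ⟨j, hj⟩ := hrodd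
    have hsq : IsSquare c := by
      rw [FiniteField.isSquare_iff hchar hc, ← Nat.card_eq_fintype_card, hL]
      have h1 : r ^ 2 / 2 = 2 * j * (j + 1) := by
        rw [hj, show (2 * j + 1) ^ 2 = 2 * (2 * j * (j + 1)) + 1 by ring]; omega
      have h2 : c ^ (2 * j) = 1 := by
        rw [hj, pow_succ] at hcr
        exact (mul_eq_right₀ hc).mp hcr
      rw [h1, pow_mul, h2, one_pow]
    rw [hχq, (quadraticChar_one_iff_isSquare hc).mpr hsq, Int.cast_one]
  have hχF (c : Fq) (hc : c ≠ 0) : χ₂ (algebraMap Fq Fqn c) = 1 := by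
    refine hfix _ (by simpa using hc) ?_
    rw [← map_pow, hr, ← hcard, FiniteField.pow_card_pow]
  have hneg : χ₂ (-a) = χ₂ a := by
    rw [neg_eq_neg_one_mul, map_mul, hfix (-1) (by simp) hrodd.neg_one_pow, one_mul]
  obtain ⟨ψ, hψ⟩ : ∃ ψ : AddChar Fq ℂ, ψ.IsPrimitive :=
    ⟨_, AddChar.FiniteField.primitiveChar_to_Complex_isPrimitive Fq⟩
  have hψ1 : ψ ≠ 1 := by simpa using hψ one_ne_zero
  have hS := card_mul_sum_ker_trace (F := Fq) χ₂ hχ1 hχF ψ hψ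
  rw [gaussSum_quadratic_of_card_sq (by rw [hcard]) hrodd hL hchar χ₂ hχ1 hχq hfix
    ψ hψ1, hcard] at hS
  have hker := card_mul_card_ker_trace Fq Fqn
  have hN : (curveCard Fq Fqn 2 a b : ℂ)
      = ∑ x : Fqn, χ₂ (a * x * algebraMap Fq Fqn (Algebra.trace Fq Fqn x) + b)
        + Fintype.card Fqn := by
    have h := congrArg (Int.cast : ℤ → ℂ) (curveCard_two (F := Fq) hchar a b)
    push_cast at h
    simp_rw [h, hχq, Finset.sum_add_distrib]
    simp
  have hτ : tauC p ^ (2 * (k + 1) * s) = -(-1) ^ ((r + 1) / 2) := by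
    rw [mul_assoc, tauC_pow_two_mul hp, hr, hq, ← pow_mul, mul_comm s]
  have hq0 : (q : ℂ) ≠ 0 := by
    have := hqodd.pos
    exact_mod_cast this.ne'
  rw [hcard, hcardn] at hker
  have hkerC : (q : ℂ) * (Finset.card {x : Fqn | Algebra.trace Fq Fqn x = 0} : ℂ)
      = (q : ℂ) ^ (2 * (k + 1)) := by exact_mod_cast hker
  rw [hN, sum_mulChar_mul_trace_add χ₂ hχ1 hχF ha hB, hτ, hneg, hcardn]
  apply mul_left_cancel₀ hq0
  rw [show 2 * (k + 1) - 1 = 2 * k + 1 by omega, show (2 * (k + 1) - 2) / 2 = k by omega]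
  rw [hr] at hS ⊢
  push_cast at hS ⊢
  linear_combination χ₂ b * hkerC - χ₂ a * hS
end

section
/- Let q = p^s with p an odd prime, d > 2 a divisor of (q^n−1)/(q−1) that is (p,r)-admissible (i.e. d | p^r + 1 and r is minimal with this property), and suppose ns/(2r) is even. Then for the curve y^d = −x·Tr(x) over F_{q^n}, the quantity N = |X(F_{q^n})| − q^n + (−1)^s q^{n−1} Σ_{ℓ=1}^{d−1} χ_d^ℓ(0) satisfies N = |X(F_{q^n})| − q^n = (d−1)(q−1)·q^{(n−2)/2}; that is, |X(F_{q^n})| = q^n + (d−1)(q−1)q^{(n−2)/2}. -/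
section CyclicPowers

variable {G : Type*} [CommGroup G] [IsCyclic G] [Finite G]

theorem exists_pow_eq_of_pow_eq_one {d e : ℕ} (h : Nat.card G = d * e) {u : G} (hu : u ^ e = 1) :
    ∃ v : G, v ^ d = u := by
  have hpos : 0 < d * e := h ▸ Nat.card_pos
  have hd : 0 < d := Nat.pos_of_mul_pos_right hpos
  have hle : (powMonoidHom d : G →* G).range ≤ (powMonoidHom e : G →* G).ker := by
    rintro _ ⟨v, rfl⟩
    simp [MonoidHom.mem_ker, ← pow_mul, ← h]
  have heq := Subgroup.eq_of_le_of_card_ge hle (by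
    rw [IsCyclic.card_powMonoidHom_ker, IsCyclic.card_powMonoidHom_range, h,
      Nat.gcd_eq_right (Dvd.intro _ rfl), Nat.gcd_eq_right (Dvd.intro_left _ rfl),
      Nat.mul_div_cancel_left _ hd])
  have : u ∈ (powMonoidHom d : G →* G).range := by
    rw [heq]; simpa [MonoidHom.mem_ker] using hu
  simpa using this

theorem pow_eq_one_iff_exists_pow_eq {d e : ℕ} (h : Nat.card G = d * e) {u : G} :
    u ^ e = 1 ↔ ∃ v : G, v ^ d = u := by
  refine ⟨exists_pow_eq_of_pow_eq_one h, ?_⟩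
  rintro ⟨v, rfl⟩
  rw [← pow_mul, ← h, pow_card_eq_one']

theorem card_filter_pow_eq_one {G : Type*} [CommGroup G] [IsCyclic G] [Fintype G] [DecidableEq G]
    {e : ℕ} (h : e ∣ Nat.card G) :
    (Finset.univ.filter fun u : G => u ^ e = 1).card = e := by
  have := IsCyclic.card_powMonoidHom_ker (G := G) e
  rw [Nat.gcd_eq_right h] at this
  replace this : Nat.card {u : G // u ^ e = 1} = e := this
  rwa [Nat.card_eq_fintype_card, Fintype.card_subtype] at this

theorem sum_comp_pow {G : Type*} [CommGroup G] [IsCyclic G] [Fintype G] [DecidableEq G]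
    {d : ℕ} (h : d ∣ Nat.card G) (f : G → ℂ) :
    ∑ u, f (u ^ d) = d * ∑ v ∈ Finset.univ.image (fun u : G => u ^ d), f v := by
  rw [Finset.sum_comp f (fun u : G => u ^ d), Finset.mul_sum]
  refine Finset.sum_congr rfl fun v hv => ?_
  rw [nsmul_eq_mul]
  congr 2
  have := MonoidHom.card_fiber_eq_of_mem_range (powMonoidHom d : G →* G) (x := v) (y := 1)
    (by simpa using hv) ⟨1, by simp⟩
  simp only [powMonoidHom_apply] at this
  rw [this, card_filter_pow_eq_one h]

end CyclicPowers

theorem sum_eq_add_sum_units {K : Type*} [Field K] [Fintype K] [DecidableEq K] (f : K → ℂ) :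
    ∑ x, f x = f 0 + ∑ u : Kˣ, f u := by
  rw [← Finset.add_sum_erase _ _ (Finset.mem_univ (0 : K))]
  congr 1
  symm
  refine Finset.sum_bij (fun u _ => (u : K)) (by simp) (fun _ _ _ _ h => Units.ext h) ?_ (by simp)
  intro b hb
  exact ⟨Units.mk0 b (by simpa using hb), by simp, rfl⟩

theorem AddChar.isIntegral_apply {K : Type*} [Field K] [Fintype K] (ψ : AddChar K ℂ) (x : K) : IsIntegral ℤ (ψ x) := by
  refine IsIntegral.of_pow (n := Fintype.card K) Fintype.card_pos ?_
  rw [← AddChar.map_nsmul_eq_pow, card_nsmul_eq_zero, AddChar.map_zero_eq_one]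
  exact isIntegral_one

theorem int_dvd_of_mul_isIntegral {k : ℤ} {d : ℕ} (hd : d ≠ 0) {α : ℂ} (hα : IsIntegral ℤ α)
    (h : (k : ℂ) = d * α) : (d : ℤ) ∣ k := by
  have hq : α = algebraMap ℚ ℂ ((k : ℚ) / d) := by
    have : (d : ℂ) ≠ 0 := by exact_mod_cast hd
    simp only [eq_ratCast]; push_cast
    rw [h]; field_simp
  rw [hq, isIntegral_algebraMap_iff (algebraMap ℚ ℂ).injective,
    IsIntegrallyClosed.isIntegral_iff] at hα
  obtain ⟨y, hy⟩ := hα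
  refine ⟨y, ?_⟩
  have : (d : ℚ) ≠ 0 := by exact_mod_cast hd
  rw [eq_div_iff this] at hy
  simp only [eq_intCast] at hy
  rw [mul_comm]
  exact_mod_cast hy.symm

section Hermitian

variable {K : Type*} [Field K] [Fintype K] [DecidableEq K] {ψ : AddChar K ℂ} {R : ℕ}

theorem sum_comp_mul_pow (hψ : ψ ≠ 1) (hR : R ≠ 0)
    (hadd : ∀ x y : K, (x + y) ^ R = x ^ R + y ^ R) (c : K) :
    ∑ y, ψ (c * y ^ R) = if c = 0 then (Fintype.card K : ℂ) else 0 := by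
  have hinj : Function.Injective fun x : K => x ^ R := by
    intro x y hxy
    have h := hadd (x - y) y
    simp only [sub_add_cancel] at h hxy
    rw [hxy, right_eq_add] at h
    exact sub_eq_zero.mp (pow_eq_zero_iff hR |>.mp h)
  have hbij := Finite.injective_iff_bijective.mp hinj
  have h := AddChar.sum_mulShift c (AddChar.IsPrimitive.of_ne_one hψ)
  rw [← hbij.sum_comp] at h
  simpa [mul_comm] using h

theorem hermitian_sum_mul_conj (hψ : ψ ≠ 1) (hR : R ≠ 0)
    (hadd : ∀ x y : K, (x + y) ^ R = x ^ R + y ^ R) (hfrob : ∀ x, ψ (x ^ R) = ψ x) {a : K}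
    (ha : ∀ z : K, z ≠ 0 → a * z + a ^ R * z ^ (R * R) ≠ 0) :
    (∑ x, ψ (a * x ^ (R + 1))) * starRingEnd ℂ (∑ x, ψ (a * x ^ (R + 1))) = Fintype.card K := by
  have key (y z : K) : ψ (a * (y + z) ^ (R + 1)) * ψ (-(a * y ^ (R + 1)))
      = ψ (a * z ^ (R + 1)) * ψ ((a * z + a ^ R * z ^ (R * R)) * y ^ R) := by
    have h1 : ψ (a * z ^ R * y) = ψ (a ^ R * z ^ (R * R) * y ^ R) := by
      rw [← hfrob (a * z ^ R * y)]; congr 1; ring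
    rw [add_mul, AddChar.map_add_eq_mul, ← h1, ← AddChar.map_add_eq_mul, ← AddChar.map_add_eq_mul,
      ← AddChar.map_add_eq_mul, pow_succ, hadd]
    congr 1; ring
  calc _ = ∑ y, ∑ x, ψ (a * x ^ (R + 1)) * ψ (-(a * y ^ (R + 1))) := by
        rw [map_sum, Finset.sum_mul_sum, Finset.sum_comm]
        simp_rw [AddChar.map_neg_eq_conj]
    _ = ∑ y, ∑ z, ψ (a * z ^ (R + 1)) * ψ ((a * z + a ^ R * z ^ (R * R)) * y ^ R) := by
        refine Finset.sum_congr rfl fun y _ => ?_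
        rw [← Equiv.sum_comp (Equiv.addLeft y)]
        exact Finset.sum_congr rfl fun z _ => key y z
    _ = ∑ z, ψ (a * z ^ (R + 1)) * if z = 0 then (Fintype.card K : ℂ) else 0 := by
        rw [Finset.sum_comm]
        refine Finset.sum_congr rfl fun z _ => ?_
        rw [← Finset.mul_sum, sum_comp_mul_pow hψ hR hadd]
        rcases eq_or_ne z 0 with rfl | hz
        · simp [hR]
        · rw [if_neg (ha z hz), if_neg hz]
    _ = Fintype.card K := by simp

end Hermitian

theorem exists_even_pow_sub_one_eq {R t : ℕ} (hR : Odd R) (ht : Even t) :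
    ∃ W, Even W ∧ R ^ (2 * t) - 1 = (R + 1) * ((R - 1) * W) := by
  obtain ⟨s, rfl⟩ := ht
  obtain ⟨V, hV⟩ : R ^ 2 - 1 ∣ (R ^ 2) ^ s - 1 := by
    simpa using Nat.sub_dvd_pow_sub_pow (R ^ 2) 1 s
  refine ⟨((R ^ 2) ^ s + 1) * V, ((hR.pow.pow).add_odd odd_one).mul_right V, ?_⟩
  have h1 : R ^ (2 * (s + s)) - 1 = ((R ^ 2) ^ s + 1) * ((R ^ 2) ^ s - 1) := by
    rw [← Nat.sq_sub_sq, one_pow]; congr 1; ring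
  have h2 : R ^ 2 - 1 = (R + 1) * (R - 1) := by rw [← Nat.sq_sub_sq, one_pow]
  rw [h1, hV, h2]; ring

section PowerSums

variable {K : Type*} [Field K] [Fintype K] [DecidableEq K] {ψ : AddChar K ℂ} {R t : ℕ}

theorem sum_units_mul_pow_eq_of_not_exists (hψ : ψ ≠ 1) (hR : Odd R) (hR3 : 3 ≤ R)
    (ht : Even t) (hcard : Fintype.card K = R ^ (2 * t))
    (hadd : ∀ x y : K, (x + y) ^ R = x ^ R + y ^ R) (hfrob : ∀ x, ψ (x ^ R) = ψ x)
    {a : Kˣ} (ha : ¬ ∃ v : Kˣ, v ^ (R + 1) = a) :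
    ∑ u : Kˣ, ψ (a * u ^ (R + 1) : Kˣ) = (R : ℂ) ^ t - 1 := by
  obtain ⟨W, hW, hWeq⟩ := exists_even_pow_sub_one_eq hR ht
  have hG : Nat.card Kˣ = (R + 1) * ((R - 1) * W) := by
    rw [Nat.card_units, Nat.card_eq_fintype_card, hcard, hWeq]
  have hpow {b : Kˣ} (hb : b ^ (R - 1) = -1) : ∃ v : Kˣ, v ^ (R + 1) = b :=
    exists_pow_eq_of_pow_eq_one hG (by rw [pow_mul, hb, hW.neg_one_pow])
  have hne (z : K) (hz : z ≠ 0) : (a : K) * z + (a : K) ^ R * z ^ (R * R) ≠ 0 := by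
    intro h
    lift z to Kˣ using hz.isUnit
    obtain ⟨k, rfl⟩ : ∃ k, R = k + 1 := ⟨R - 1, by omega⟩
    obtain ⟨v, hv⟩ := hpow (b := a * z ^ (k + 1 + 1)) (by
      rw [Nat.add_sub_cancel]
      have h' : ((a * z : Kˣ) : K) * (((a * z ^ (k + 1 + 1)) ^ k : Kˣ) + 1) = 0 := by
        rw [← h]; push_cast; ring
      rw [Units.mul_right_eq_zero] at h'
      ext
      simpa using eq_neg_of_add_eq_zero_left h')
    exact ha ⟨v * z⁻¹, by rw [mul_pow, hv, inv_pow, mul_inv_cancel_right]⟩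
  set T := ∑ u : Kˣ, ψ (a * u ^ (R + 1) : Kˣ) with hT
  have hS : ∑ x, ψ (a * x ^ (R + 1)) = 1 + T := by
    rw [sum_eq_add_sum_units]; simp [hT]
  obtain ⟨e, he⟩ : ∃ e : Kˣ, e ^ (R + 1) = -1 :=
    exists_pow_eq_of_pow_eq_one hG (by rw [mul_comm, pow_mul, hW.neg_one_pow, one_pow])
  have hconj : starRingEnd ℂ T = T := by
    rw [hT, map_sum, ← Equiv.sum_comp (Equiv.mulLeft e)]
    refine Finset.sum_congr rfl fun u _ => ?_
    rw [← AddChar.map_neg_eq_conj]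
    simp [mul_pow, he]
  have hsq : (1 + T - (R : ℂ) ^ t) * (1 + T + (R : ℂ) ^ t) = 0 := by
    have h := hermitian_sum_mul_conj hψ (by omega) hadd hfrob hne
    rw [hS, map_add, map_one, hconj, hcard] at h
    push_cast at h
    linear_combination h
  rcases mul_eq_zero.mp hsq with h | h
  · linear_combination h
  exfalso
  have hT_eq := sum_comp_pow (Dvd.intro _ hG.symm) fun u : Kˣ => ψ (a * u : Kˣ)
  rw [← hT] at hT_eq
  have hdvd : ((R + 1 : ℕ) : ℤ) ∣ -((R : ℤ) ^ t) - 1 := by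
    refine int_dvd_of_mul_isIntegral (by omega)
      (IsIntegral.sum _ fun v _ => AddChar.isIntegral_apply ψ (a * v : Kˣ)) (hT_eq.symm.trans ?_).symm
    push_cast
    linear_combination h
  have hdvd' : ((R + 1 : ℕ) : ℤ) ∣ (R : ℤ) ^ t - 1 := by
    obtain ⟨s, rfl⟩ := ht
    rw [← two_mul, pow_mul]
    refine Dvd.dvd.trans ⟨(R : ℤ) - 1, by push_cast; ring⟩ (sub_one_dvd_pow_sub_one _ s)
  have := Int.le_of_dvd (by norm_num) ((dvd_neg.mpr (dvd_add hdvd hdvd')).trans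
    (by ring_nf; exact dvd_rfl : _ ∣ (2 : ℤ)))
  push_cast at this
  omega

theorem sum_units_pow_add_one_eq (hψ : ψ ≠ 1) (hR : Odd R) (hR3 : 3 ≤ R)
    (ht : Even t) (hcard : Fintype.card K = R ^ (2 * t))
    (hadd : ∀ x y : K, (x + y) ^ R = x ^ R + y ^ R) (hfrob : ∀ x, ψ (x ^ R) = ψ x)
    {d : ℕ} (hd : d ∣ R + 1) :
    ∑ u : Kˣ, ψ (u ^ d : Kˣ) = (R : ℂ) ^ t - 1 - d * (R : ℂ) ^ t := by
  obtain ⟨W, -, hWeq⟩ := exists_even_pow_sub_one_eq hR ht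
  have hG : Nat.card Kˣ = (R + 1) * ((R - 1) * W) := by
    rw [Nat.card_units, Nat.card_eq_fintype_card, hcard, hWeq]
  set N := (R - 1) * W
  have hN0 : (N : ℂ) ≠ 0 := by
    have : 0 < Nat.card Kˣ := Nat.card_pos
    rw [hG] at this
    exact_mod_cast (Nat.pos_of_mul_pos_left this).ne'
  have hcardG : (Fintype.card Kˣ : ℂ) = (R + 1) * N := by
    rw [← Nat.card_eq_fintype_card, hG]; push_cast; ring
  set η : Kˣ → ℂ := fun a => ∑ u : Kˣ, ψ (a * u ^ (R + 1) : Kˣ) with hη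
  have hη_eq (a : Kˣ) : η a = ((R : ℂ) ^ t - 1) + if a ^ N = 1 then η 1 - ((R : ℂ) ^ t - 1) else 0 := by
    split_ifs with h
    · obtain ⟨v, rfl⟩ := (pow_eq_one_iff_exists_pow_eq hG).mp h
      rw [add_sub_cancel]
      simp only [hη]
      rw [← Equiv.sum_comp (Equiv.mulLeft v) fun u : Kˣ => ψ (1 * u ^ (R + 1) : Kˣ)]
      simp [mul_pow]
    · rw [add_zero]
      exact sum_units_mul_pow_eq_of_not_exists hψ hR hR3 ht hcard hadd hfrob
        fun hv => h ((pow_eq_one_iff_exists_pow_eq hG).mpr hv)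
  have hsum (g : Kˣ → ℂ) (v : Kˣ) : ∑ u, g (u * v) = ∑ u, g u :=
    Equiv.sum_comp (Equiv.mulRight v) g
  have hψsum : ∑ u : Kˣ, ψ u = -1 := by
    have h := AddChar.sum_eq_zero_of_ne_one hψ
    rw [sum_eq_add_sum_units, AddChar.map_zero_eq_one] at h
    linear_combination h
  have hη1 : η 1 = -1 - R * (R : ℂ) ^ t := by
    have h : ∑ a, η a = -(Fintype.card Kˣ : ℂ) := by
      simp only [hη]
      rw [Finset.sum_comm]
      simp_rw [hsum (fun u : Kˣ => ψ u), hψsum]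
      simp
    rw [Finset.sum_congr rfl fun a _ => hη_eq a] at h
    rw [Finset.sum_add_distrib, ← Finset.sum_filter, Finset.sum_const, Finset.sum_const,
      card_filter_pow_eq_one (Dvd.intro_left _ hG.symm), Finset.card_univ, nsmul_eq_mul,
      nsmul_eq_mul, hcardG] at h
    have h2 : (N : ℂ) * (η 1) = N * (-1 - R * (R : ℂ) ^ t) := by linear_combination h
    exact mul_left_cancel₀ hN0 h2
  obtain ⟨c, hc⟩ := hd
  have havg : ∑ v : Kˣ, η (v ^ d) = Fintype.card Kˣ * ∑ u : Kˣ, ψ (u ^ d : Kˣ) := by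
    simp only [hη]
    rw [Finset.sum_comm]
    have (u : Kˣ) : ∑ v : Kˣ, ψ (v ^ d * u ^ (R + 1) : Kˣ) = ∑ v : Kˣ, ψ (v ^ d : Kˣ) := by
      rw [← hsum (fun v : Kˣ => ψ (v ^ d : Kˣ)) (u ^ c), hc]
      simp only [mul_pow, ← pow_mul, mul_comm c d]
    simp_rw [this]
    simp
  rw [Finset.sum_congr rfl fun v _ => hη_eq (v ^ d)] at havg
  simp only [← pow_mul] at havg
  rw [Finset.sum_add_distrib, ← Finset.sum_filter, Finset.sum_const, Finset.sum_const,
    card_filter_pow_eq_one ⟨c, by rw [hG, hc]; ring⟩, Finset.card_univ, nsmul_eq_mul,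
    nsmul_eq_mul, hcardG, hη1] at havg
  have hR1 : ((R : ℂ) + 1) ≠ 0 := by exact_mod_cast (by omega : R + 1 ≠ 0)
  refine mul_left_cancel₀ (mul_ne_zero hR1 hN0) (havg.symm.trans ?_)
  push_cast
  ring

end PowerSums

section TraceCount

theorem exists_addChar_trace_pow_char (F K : Type*) [Field F] [Field K] [Fintype F] [Fintype K]
    [Algebra F K] (p : ℕ) [Fact p.Prime] [CharP F p] :
    ∃ φ : AddChar F ℂ, φ ≠ 1 ∧
      ∀ x : K, φ (Algebra.trace F K (x ^ p)) = φ (Algebra.trace F K x) := by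
  have : CharP K p := charP_of_injective_algebraMap (algebraMap F K).injective p
  let := ZMod.algebra F p
  let := ZMod.algebra K p
  have : IsScalarTower (ZMod p) F K := IsScalarTower.of_algebraMap_eq' (Subsingleton.elim _ _)
  refine ⟨(ZMod.stdAddChar (N := p)).compAddMonoidHom
    (Algebra.trace (ZMod p) F).toAddMonoidHom, fun h => ?_, fun x => ?_⟩
  · refine ZMod.isPrimitive_stdAddChar p one_ne_zero ?_
    ext y
    obtain ⟨x, hx⟩ := Algebra.trace_surjective (ZMod p) F y
    have := DFunLike.congr_fun h x
    simp only [AddChar.compAddMonoidHom_apply, LinearMap.toAddMonoidHom_coe, hx] at this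
    simpa using this
  · simp only [AddChar.compAddMonoidHom_apply, LinearMap.toAddMonoidHom_coe, Algebra.trace_trace]
    have h := Algebra.trace_eq_of_algEquiv
      (FiniteField.frobeniusAlgEquivOfAlgebraic (ZMod p) K) x
    rw [FiniteField.coe_frobeniusAlgEquivOfAlgebraic, ZMod.card] at h
    rw [h]

theorem card_mul_card_trace_eq_zero {F K : Type*} [Field F] [Field K] [Fintype F] [Algebra F K]
    [DecidableEq F] {φ : AddChar F ℂ} (hφ : φ ≠ 1)
    {ι : Type*} [Fintype ι] (f : ι → K) :
    (Fintype.card F : ℂ) * (Finset.univ.filter fun i => Algebra.trace F K (f i) = 0).card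
      = ∑ c : F, ∑ i, φ (Algebra.trace F K (c • f i)) := by
  rw [Finset.sum_comm]
  simp_rw [map_smul, smul_eq_mul, AddChar.sum_mulShift _ (AddChar.IsPrimitive.of_ne_one hφ)]
  simp [Finset.sum_ite, mul_comm]

theorem exists_pow_eq_algebraMap {F K : Type*} [Field F] [Field K] [Fintype F] [Fintype K]
    [Algebra F K] {d : ℕ}
    (hd : d ∣ (Fintype.card K - 1) / (Fintype.card F - 1)) {c : F} (hc : c ≠ 0) :
    ∃ e : Kˣ, (e : K) ^ d = algebraMap F K c := by
  obtain ⟨m, hm⟩ := hd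
  have hdvd : Fintype.card F - 1 ∣ Fintype.card K - 1 := by
    rw [Module.card_eq_pow_finrank (K := F) (V := K)]
    simpa using Nat.sub_dvd_pow_sub_pow (Fintype.card F) 1 (Module.finrank F K)
  have hG : Nat.card Kˣ = d * ((Fintype.card F - 1) * m) := by
    rw [Nat.card_units, Nat.card_eq_fintype_card, ← Nat.div_mul_cancel hdvd, hm]; ring
  have hc' : algebraMap F K c ≠ 0 := by simpa using hc
  obtain ⟨e, he⟩ := exists_pow_eq_of_pow_eq_one hG (u := Units.mk0 _ hc') (by
    ext
    simp [← map_pow, pow_mul, FiniteField.pow_card_sub_one_eq_one c hc])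
  exact ⟨e, by simpa using congrArg Units.val he⟩

theorem curveCard_neg_one_zero {F K : Type} [Field F] [Field K] [Fintype F] [Fintype K]
    [Algebra F K] [DecidableEq F] {d : ℕ} (hd0 : d ≠ 0)
    (hd : d ∣ (Fintype.card K - 1) / (Fintype.card F - 1)) :
    curveCard F K d (-1) 0 =
      (Finset.univ.filter fun x : K => Algebra.trace F K x = 0).card +
      (Finset.univ.filter fun y : K => Algebra.trace F K (y ^ d) ≠ 0).card := by
  classical
  have hfib (x : K) : Nat.card {y : K // y ^ d = -1 * x * algebraMap F K (Algebra.trace F K x) + 0}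
      = if Algebra.trace F K x = 0 then 1 else
        (Finset.univ.filter fun y : K => y ^ d = x).card := by
    split_ifs with h
    · rw [Nat.card_eq_one_iff_unique]
      simp only [h, map_zero, mul_zero, add_zero, pow_eq_zero_iff hd0]
      exact ⟨inferInstance, ⟨⟨0, rfl⟩⟩⟩
    · obtain ⟨e, he⟩ := exists_pow_eq_algebraMap (K := K) hd (neg_ne_zero.mpr h)
      rw [← Fintype.card_subtype, ← Nat.card_eq_fintype_card]
      refine (Nat.card_congr ((Equiv.mulLeft₀ (e : K) e.ne_zero).subtypeEquiv fun y => ?_)).symm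
      rw [Equiv.mulLeft₀_apply, mul_pow, he, map_neg, neg_one_mul, add_zero, neg_mul, neg_mul,
        neg_inj, mul_comm x, mul_right_inj' (by simpa using h)]
  rw [curveCard, Nat.card_congr (Equiv.subtypeProdEquivSigmaSubtype fun x y : K =>
    y ^ d = -1 * x * algebraMap F K (Algebra.trace F K x) + 0), Nat.card_sigma]
  simp_rw [hfib]
  rw [Finset.sum_ite, Finset.sum_const, smul_eq_mul, mul_one]
  congr 1
  rw [Finset.card_eq_sum_card_fiberwise (f := fun y : K => y ^ d)
    (t := Finset.univ.filter fun x : K => ¬ Algebra.trace F K x = 0)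
    (fun y hy => by simpa using hy)]
  refine Finset.sum_congr rfl fun x hx => ?_
  congr 1
  ext y
  simp only [Finset.mem_filter, Finset.mem_univ, true_and] at hx ⊢
  exact ⟨fun h => ⟨h ▸ hx, h⟩, fun h => h.2⟩

end TraceCount

theorem curve_card_admissible (p s n r : ℕ) [Fact p.Prime] (hp : Odd p) (hs : 0 < s)
    (hn : 0 < n) (hr : 0 < r) (q : ℕ) (hq : q = p ^ s)
    (Fq Fqn : Type) [Field Fq] [Field Fqn] [Fintype Fq] [Fintype Fqn] [Algebra Fq Fqn]
    (hcard : Fintype.card Fq = q) (hcardn : Fintype.card Fqn = q ^ n)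
    (d : ℕ) (hd2 : 2 < d) (hdvd : d ∣ (q ^ n - 1) / (q - 1))
    -- `(p,r)`-admissibility: `d ∣ p^r + 1` and `r` is minimal with this property
    (hadm : d ∣ p ^ r + 1) (hmin : ∀ r' : ℕ, 0 < r' → r' < r → ¬ d ∣ p ^ r' + 1)
    (h2r : 2 * r ∣ n * s) (heven : Even (n * s / (2 * r))) :
    (curveCard Fq Fqn d (-1) 0 : ℂ)
      = (q : ℂ) ^ n + (d - 1 : ℂ) * ((q : ℂ) - 1) * (Real.sqrt q ^ (n - 2) : ℝ) := by
  classical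
  have hp3 : 3 ≤ p := by
    have hp2 : 2 ≤ p := (Fact.out : p.Prime).two_le
    obtain ⟨k, rfl⟩ := hp; omega
  have hq3 : 3 ≤ q := hp3.trans (hq ▸ Nat.le_self_pow hs.ne' p)
  have hn2 : 2 ≤ n := by
    by_contra h
    obtain rfl : n = 1 := by omega
    rw [pow_one, Nat.div_self (by omega)] at hdvd
    have := Nat.le_of_dvd one_pos hdvd
    omega
  obtain ⟨t, ht⟩ := h2r
  rw [ht, Nat.mul_div_cancel_left _ (by omega)] at heven
  have hQ : q ^ n = (p ^ r) ^ (2 * t) := by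
    rw [hq, ← pow_mul, ← pow_mul, mul_comm s n, ht]; ring
  have : CharP Fq p := charP_of_card_eq_prime_pow (hcard.trans hq)
  have : CharP Fqn p := charP_of_injective_algebraMap (algebraMap Fq Fqn).injective p
  obtain ⟨φ, hφ, hφp⟩ := exists_addChar_trace_pow_char Fq Fqn p
  let ψ : AddChar Fqn ℂ := φ.compAddMonoidHom (Algebra.trace Fq Fqn).toAddMonoidHom
  have hψ_apply (x : Fqn) : φ (Algebra.trace Fq Fqn x) = ψ x := rfl
  have hψ : ψ ≠ 1 := fun h => hφ <| by
    ext y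
    obtain ⟨x, rfl⟩ := Algebra.trace_surjective Fq Fqn y
    rw [hψ_apply, h, AddChar.one_apply, AddChar.one_apply]
  have hfrob (k : ℕ) (x : Fqn) : ψ (x ^ p ^ k) = ψ x := by
    induction k with
    | zero => simp
    | succ k ih => rw [pow_succ, pow_mul, ← hψ_apply, hφp, hψ_apply, ih]
  have hsum := sum_units_pow_add_one_eq hψ hp.pow (hp3.trans (Nat.le_self_pow hr.ne' p)) heven
    (hcardn.trans hQ) (fun x y => add_pow_char_pow x y p r) (hfrob r) hadm
  have hd : d ∣ (Fintype.card Fqn - 1) / (Fintype.card Fq - 1) := by rwa [hcardn, hcard]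
  set P : ℂ := ((p ^ r : ℕ) : ℂ) ^ t with hP
  have hsumc {c : Fq} (hc : c ≠ 0) : ∑ y : Fqn, ψ (c • y ^ d) = P - d * P := by
    obtain ⟨e, he⟩ := exists_pow_eq_algebraMap (K := Fqn) hd hc
    rw [← Equiv.sum_comp (Equiv.mulLeft₀ (e : Fqn) e.ne_zero).symm]
    have (y : Fqn) : c • ((Equiv.mulLeft₀ (e : Fqn) e.ne_zero).symm y) ^ d = y ^ d := by
      obtain ⟨y, rfl⟩ := (Equiv.mulLeft₀ (e : Fqn) e.ne_zero).surjective y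
      rw [Equiv.symm_apply_apply, Equiv.mulLeft₀_apply, mul_pow, he, Algebra.smul_def]
    simp_rw [this]
    rw [sum_eq_add_sum_units, zero_pow (by omega), AddChar.map_zero_eq_one]
    simp_rw [← Units.val_pow_eq_pow_val]
    rw [hsum]
    ring
  have hsplit {g : Fq → ℂ} {S : ℂ} (h : ∀ c ≠ 0, g c = S) : ∑ c, g c = g 0 + (q - 1) * S := by
    rw [← Finset.add_sum_erase _ _ (Finset.mem_univ (0 : Fq)),
      Finset.sum_congr rfl fun c hc => h c (Finset.ne_of_mem_erase hc), Finset.sum_const,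
      Finset.card_erase_of_mem (Finset.mem_univ _), Finset.card_univ, hcard, nsmul_eq_mul,
      Nat.cast_pred (by omega)]
  have hA := card_mul_card_trace_eq_zero (K := Fqn) hφ id
  have hB := card_mul_card_trace_eq_zero (K := Fqn) hφ fun y : Fqn => y ^ d
  simp only [hψ_apply, id_eq] at hA hB
  rw [hsplit fun c hc => hsumc hc] at hB
  rw [hsplit (S := 0) fun c hc => by
    simpa [Algebra.smul_def, mul_comm, hc] using AddChar.sum_mulShift (algebraMap Fq Fqn c)
      (AddChar.IsPrimitive.of_ne_one hψ)] at hA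
  simp only [zero_smul, AddChar.map_zero_eq_one, Finset.sum_const, Finset.card_univ, hcard,
    hcardn, nsmul_eq_mul, mul_one, mul_zero, add_zero] at hA hB
  have hC := Finset.card_filter_add_card_filter_not (s := Finset.univ)
    fun y : Fqn => Algebra.trace Fq Fqn (y ^ d) = 0
  rw [Finset.card_univ, hcardn] at hC
  have hC' := congrArg (Nat.cast : ℕ → ℂ) hC
  have hsqrt : (q : ℂ) * (Real.sqrt q ^ (n - 2) : ℝ) = P := by
    have h : (q : ℝ) * Real.sqrt q ^ (n - 2) = ((p ^ r : ℕ) : ℝ) ^ t := by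
      rw [← pow_left_inj₀ (by positivity) (by positivity) two_ne_zero, ← pow_mul, mul_comm t 2]
      rw [mul_pow, ← pow_mul, mul_comm (n - 2) 2, pow_mul, Real.sq_sqrt (by positivity), ← pow_add,
        Nat.add_sub_cancel' hn2]
      exact_mod_cast hQ
    rw [hP]
    exact_mod_cast congrArg (Complex.ofReal) h
  have hq0 : (q : ℂ) ≠ 0 := by exact_mod_cast (by omega : q ≠ 0)
  refine mul_left_cancel₀ hq0 ?_
  rw [curveCard_neg_one_zero (by omega) hd]
  push_cast at hA hB hC' ⊢
  push_cast at hsqrt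
  linear_combination hA - hB + q * hC' - (d - 1) * (q - 1) * hsqrt
end

section
/- Let q = p^s with p an odd prime, d a divisor of q^n − 1, a ∈ F_{q^n}*, b ∈ F_{q^n}, v = gcd(d, (q^n−1)/(q−1)), D = d/v, and suppose D is odd and B = Tr(b/a) = 0. Then |X(F_{q^n})| = q^n + q^{n−1} Σ_{ℓ=1}^{d−1} χ_d^ℓ(b) − ((q−1)/q) Σ_{j=1}^{v−1} G_n(χ_d^{jD}) χ_d^{jD}(−a), where X is the curve y^d = a·x·Tr(x) + b and G_n denotes the Gauss sum over F_{q^n}. -/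
/-- The Gauss sum `G(χ) = Σ_x χ(x)·ψ(x)` (recall `χ(0)=0`). -/
noncomputable def gaussSum' (p : ℕ) [Fact p.Prime] (F : Type) [Field F] [Fintype F] [CharP F p]
    (χ : MulChar F ℂ) : ℂ :=
  ∑ x : F, χ x * psiC p F x

open Finset

section PowerResidues

variable {F : Type} [Field F] [Fintype F]

theorem exists_isPrimitiveRoot_of_dvd_card_sub_one {d : ℕ} (hd : d ∣ Fintype.card F - 1) :
    ∃ ζ : F, IsPrimitiveRoot ζ d := by
  obtain ⟨g, hg⟩ := IsCyclic.exists_generator (α := Fˣ)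
  obtain ⟨k, hk⟩ := hd
  have hcard : orderOf g = Fintype.card F - 1 := by
    rw [orderOf_eq_card_of_forall_mem_zpowers hg, Nat.card_units, Nat.card_eq_fintype_card]
  have hpos : 0 < Fintype.card F - 1 := Nat.sub_pos_of_lt Fintype.one_lt_card
  have h := (IsPrimitiveRoot.orderOf g).pow (hcard ▸ hpos) (hcard.trans (hk.trans (mul_comm d k)))
  exact ⟨_, IsPrimitiveRoot.coe_units_iff.mpr h⟩

theorem mulChar_apply_eq_one_iff_exists_pow (χ : MulChar F ℂ) {c : F} (hc : c ≠ 0) :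
    χ c = 1 ↔ ∃ y, y ^ orderOf χ = c := by
  constructor
  · intro h
    obtain ⟨g, hg⟩ := IsCyclic.exists_generator (α := Fˣ)
    obtain ⟨k, hk⟩ := (mem_powers_iff_mem_zpowers (x := g)).mpr (hg (Units.mk0 c hc))
    have hk' : (g : F) ^ k = c := by simpa using congrArg Units.val hk
    have h1 : χ ^ k = 1 := by
      rw [MulChar.eq_iff hg, MulChar.pow_apply_coe, ← map_pow, hk', h, MulChar.one_apply_coe]
    obtain ⟨m, rfl⟩ := orderOf_dvd_of_pow_eq_one h1
    exact ⟨(g : F) ^ m, by rw [← hk', mul_comm, pow_mul]⟩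
  · rintro ⟨y, rfl⟩
    have hd : orderOf χ ≠ 0 := (χ.orderOf_pos).ne'
    have hy : y ≠ 0 := by rintro rfl; exact hc (zero_pow hd)
    rw [map_pow, ← MulChar.pow_apply' χ hd, pow_orderOf_eq_one, MulChar.one_apply hy.isUnit]

theorem natCard_pow_eq_sum_mulChar (χ : MulChar F ℂ) (c : F) :
    (Nat.card {y : F // y ^ orderOf χ = c} : ℂ)
      = 1 + ∑ ℓ ∈ Icc 1 (orderOf χ - 1), (χ ^ ℓ) c := by
  classical
  have hd : 0 < orderOf χ := χ.orderOf_pos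
  by_cases hc : c = 0
  · subst hc
    rw [sum_eq_zero fun ℓ _ ↦ MulChar.map_zero _]
    have : Unique {y : F // y ^ orderOf χ = 0} :=
      { default := ⟨0, zero_pow hd.ne'⟩
        uniq := fun y ↦ Subtype.ext (pow_eq_zero_iff hd.ne' |>.mp y.2) }
    rw [Nat.card_unique, Nat.cast_one, add_zero]
  obtain ⟨ζ, hζ⟩ := exists_isPrimitiveRoot_of_dvd_card_sub_one χ.orderOf_dvd_card_sub_one
  have hL : Nat.card {y : F // y ^ orderOf χ = c}
      = if ∃ y, y ^ orderOf χ = c then orderOf χ else 0 := by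
    refine Eq.trans ?_ ((hζ.card_nthRoots c).trans (by congr))
    rw [← Multiset.toFinset_card_of_nodup (hζ.nthRoots_nodup hc),
      Nat.card_eq_fintype_card]
    exact Fintype.card_of_subtype _ fun y ↦ by simp [Polynomial.mem_nthRoots hd]
  have hR : 1 + ∑ ℓ ∈ Icc 1 (orderOf χ - 1), (χ ^ ℓ) c = ∑ ℓ ∈ range (orderOf χ), χ c ^ ℓ := by
    obtain ⟨m, hm⟩ := Nat.exists_eq_add_of_lt hd
    rw [zero_add] at hm
    rw [hm, Nat.add_sub_cancel, sum_range_succ', pow_zero, add_comm, add_left_inj]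
    rw [← Finset.Ico_add_one_right_eq_Icc, sum_Ico_eq_sum_range]
    refine sum_congr rfl fun i _ ↦ ?_
    rw [add_comm 1 i, MulChar.pow_apply' _ (Nat.succ_ne_zero i)]
  rw [hR, hL]
  by_cases h : χ c = 1
  · rw [if_pos ((mulChar_apply_eq_one_iff_exists_pow χ hc).mp h)]
    simp [h]
  · rw [if_neg (mt (mulChar_apply_eq_one_iff_exists_pow χ hc).mpr h), geom_sum_eq h,
      ← MulChar.pow_apply' χ hd.ne', pow_orderOf_eq_one, MulChar.one_apply (Ne.isUnit hc)]
    simp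

end PowerResidues

section TraceFibers

variable {K L : Type} [Field K] [Field L] [Algebra K L]

theorem card_mul_card_trace_eq_zero_s18 [Fintype K] [Fintype L] [DecidableEq K] :
    Fintype.card K * #{x : L | Algebra.trace K L x = 0} = Fintype.card L := by
  let T := (Algebra.trace K L).toAddMonoidHom
  have h := T.ker.card_mul_index
  have hs : Function.Surjective T := Algebra.trace_surjective K L
  rw [AddSubgroup.index_ker, AddMonoidHom.range_eq_top.mpr hs, AddSubgroup.card_top,
    Nat.card_eq_fintype_card, Nat.card_eq_fintype_card, Nat.card_eq_fintype_card] at h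
  rw [← h, mul_comm]
  congr 1
  exact (Fintype.card_of_subtype _ fun x ↦ by simp [T, AddMonoidHom.mem_ker]).symm

theorem sum_trace_eq [Fintype L] [DecidableEq K] (f : L → ℂ) {t : K} (ht : t ≠ 0) :
    ∑ x : L with Algebra.trace K L x = t, f x
      = ∑ u : L with Algebra.trace K L u = 1, f (algebraMap K L t * u) := by
  have ht' : algebraMap K L t ≠ 0 := by simpa using ht
  symm
  refine sum_bij' (fun u _ ↦ algebraMap K L t * u) (fun x _ ↦ (algebraMap K L t)⁻¹ * x)
    ?_ ?_ ?_ ?_ ?_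
  · intro u hu
    simp only [mem_filter, mem_univ, true_and] at hu ⊢
    rw [← Algebra.smul_def, map_smul, hu, smul_eq_mul, mul_one]
  · intro x hx
    simp only [mem_filter, mem_univ, true_and] at hx ⊢
    rw [← map_inv₀, ← Algebra.smul_def, map_smul, hx, smul_eq_mul, inv_mul_cancel₀ ht]
  · intro u _
    exact inv_mul_cancel_left₀ ht' u
  · intro x _
    exact mul_inv_cancel_left₀ ht' x
  · intro u _
    rfl

theorem sum_eq_sum_trace_zero_add [Fintype K] [Fintype L] [DecidableEq K] (f : L → ℂ) :
    ∑ x, f x = ∑ x : L with Algebra.trace K L x = 0, f x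
      + ∑ t ∈ univ.erase (0 : K),
          ∑ u : L with Algebra.trace K L u = 1, f (algebraMap K L t * u) := by
  rw [← sum_fiberwise univ (fun x : L ↦ Algebra.trace K L x) f,
    ← add_sum_erase _ _ (mem_univ (0 : K))]
  congr 1
  exact sum_congr rfl fun t ht ↦ sum_trace_eq f (ne_of_mem_erase ht)

theorem sum_trace_eq_one_add [Fintype L] [DecidableEq K] (f : L → ℂ) {c : L}
    (hc : Algebra.trace K L c = 0) :
    ∑ u : L with Algebra.trace K L u = 1, f (u + c)
      = ∑ u : L with Algebra.trace K L u = 1, f u := by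
  refine sum_bij' (fun u _ ↦ u + c) (fun u _ ↦ u - c) ?_ ?_ ?_ ?_ ?_
  all_goals simp +contextual [hc]

theorem sum_mulChar_mul_trace_add_s18 [Fintype K] [Fintype L] [DecidableEq K] (η : MulChar L ℂ) {a b : L} (ha : a ≠ 0)
    (hB : Algebra.trace K L (b / a) = 0) :
    ∑ x, η (a * x * algebraMap K L (Algebra.trace K L x) + b)
      = #{x : L | Algebra.trace K L x = 0} * η b
        + η a * (∑ t ∈ univ.erase (0 : K), (η ^ 2) (algebraMap K L t)) *
            ∑ u : L with Algebra.trace K L u = 1, η u := by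
  rw [sum_eq_sum_trace_zero_add (K := K)]
  congr 1
  · rw [← nsmul_eq_mul, ← sum_const]
    refine sum_congr rfl fun x hx ↦ ?_
    rw [(mem_filter.mp hx).2]
    simp
  · rw [mul_assoc, sum_mul, mul_sum]
    refine sum_congr rfl fun t ht ↦ ?_
    have ht0 : t ≠ 0 := ne_of_mem_erase ht
    have ht' : algebraMap K L t ≠ 0 := by simpa using ht0
    have hc : Algebra.trace K L (((t ^ 2)⁻¹ : K) • (b / a)) = 0 := by rw [map_smul, hB, smul_zero]
    rw [← sum_trace_eq_one_add η hc, mul_sum, mul_sum]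
    refine sum_congr rfl fun u hu ↦ ?_
    have hu1 : Algebra.trace K L (algebraMap K L t * u) = t := by
      rw [← Algebra.smul_def, map_smul, (mem_filter.mp hu).2, smul_eq_mul, mul_one]
    rw [hu1, MulChar.pow_apply' _ two_ne_zero, ← map_pow, ← map_mul, ← map_mul]
    congr 1
    rw [Algebra.smul_def, map_inv₀, map_pow]
    field_simp

theorem sum_erase_zero_mulChar_of_forall_eq_one [Fintype K] [DecidableEq K] (η : MulChar L ℂ)
    (h : ∀ t : K, t ≠ 0 → η (algebraMap K L t) = 1) :
    ∑ t ∈ univ.erase (0 : K), η (algebraMap K L t) = Fintype.card K - 1 := by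
  rw [sum_congr rfl fun t ht ↦ h t (ne_of_mem_erase ht), sum_const, card_erase_of_mem (mem_univ _),
    card_univ, nsmul_one, Nat.cast_sub Fintype.card_pos, Nat.cast_one]

theorem sum_erase_zero_mulChar_of_exists_ne_one [Fintype K] [DecidableEq K] (η : MulChar L ℂ)
    (h : ∃ t : K, t ≠ 0 ∧ η (algebraMap K L t) ≠ 1) :
    ∑ t ∈ univ.erase (0 : K), η (algebraMap K L t) = 0 := by
  obtain ⟨s, hs, hs1⟩ := h
  refine eq_zero_of_mul_eq_self_left hs1 ?_
  rw [mul_sum]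
  refine sum_bij' (fun t _ ↦ s * t) (fun t _ ↦ s⁻¹ * t) ?_ ?_ ?_ ?_ ?_
  all_goals simp +contextual [hs]

theorem forall_mulChar_algebraMap_eq_one_iff [Fintype K] [Fintype L] (η : MulChar L ℂ) :
    (∀ t : K, t ≠ 0 → η (algebraMap K L t) = 1)
      ↔ η ^ ((Fintype.card L - 1) / (Fintype.card K - 1)) = 1 := by
  have key : ∀ x : Lˣ, η (algebraMap K L (Algebra.norm K (x : L)))
      = (η ^ ((Fintype.card L - 1) / (Fintype.card K - 1))) x := fun x ↦ by
    rw [FiniteField.algebraMap_norm_eq_pow, Nat.card_eq_fintype_card, Nat.card_eq_fintype_card,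
      MulChar.pow_apply_coe, map_pow]
  constructor
  · intro h
    ext x
    rw [← key, h _ (Algebra.norm_ne_zero_iff.mpr x.ne_zero), MulChar.one_apply_coe]
  · intro h t ht
    obtain ⟨x, rfl⟩ := FiniteField.norm_surjective K L t
    have hx : x ≠ 0 := by rintro rfl; simp at ht
    rw [show x = (Units.mk0 x hx : L) from rfl, key, h, MulChar.one_apply_coe]

end TraceFibers

section GaussSums

variable (p : ℕ) [Fact p.Prime]

/-- The canonical additive character as a bundled `AddChar`. -/
noncomputable def canonicalAddChar (F : Type) [Field F] [Fintype F] [CharP F p] : AddChar F ℂ :=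
  letI : Algebra (ZMod p) F := ZMod.algebra F p
  ZMod.stdAddChar.compAddMonoidHom (Algebra.trace (ZMod p) F).toAddMonoidHom

theorem canonicalAddChar_apply (F : Type) [Field F] [Fintype F] [CharP F p] (x : F) :
    canonicalAddChar p F x = psiC p F x := by
  let : Algebra (ZMod p) F := ZMod.algebra F p
  have h := ZMod.stdAddChar_coe (N := p) ((Algebra.trace (ZMod p) F x).val : ℤ)
  rw [Int.cast_natCast, ZMod.natCast_zmod_val, Int.cast_natCast] at h
  exact h

theorem sum_canonicalAddChar (F : Type) [Field F] [Fintype F] [CharP F p] :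
    ∑ x, canonicalAddChar p F x = 0 := by
  let : Algebra (ZMod p) F := ZMod.algebra F p
  refine AddChar.sum_eq_zero_of_ne_one fun h ↦ ?_
  obtain ⟨x, hx⟩ := Algebra.trace_surjective (ZMod p) F 1
  have h1 : ZMod.stdAddChar (1 : ZMod p) = 1 := by
    rw [← hx]
    exact DFunLike.congr_fun h x
  exact one_ne_zero (ZMod.injective_stdAddChar (h1.trans (AddChar.map_zero_eq_one _).symm))

variable {K L : Type} [Field K] [Field L] [Fintype K] [Fintype L] [Algebra K L] [CharP K p]
  [CharP L p]

theorem canonicalAddChar_trace (x : L) :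
    canonicalAddChar p K (Algebra.trace K L x) = canonicalAddChar p L x := by
  let : Algebra (ZMod p) K := ZMod.algebra K p
  let : Algebra (ZMod p) L := ZMod.algebra L p
  have : IsScalarTower (ZMod p) K L := .of_algebraMap_eq' (Subsingleton.elim _ _)
  exact congrArg ZMod.stdAddChar (Algebra.trace_trace (R := ZMod p) (S := K) x)

theorem gaussSum'_eq_neg_card_mul_sum_trace_eq_one [DecidableEq K] {η : MulChar L ℂ} (hη : η ≠ 1)
    (h : ∀ t : K, t ≠ 0 → η (algebraMap K L t) = 1) :
    gaussSum' p L η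
      = -(Fintype.card K * ∑ u : L with Algebra.trace K L u = 1, η u) := by
  set S := ∑ u : L with Algebra.trace K L u = 1, η u with hS
  set T := ∑ x : L with Algebra.trace K L x = 0, η x with hT
  have h0 : 0 = T + (Fintype.card K - 1) * S := by
    rw [← MulChar.sum_eq_zero_of_ne_one hη, sum_eq_sum_trace_zero_add (K := K),
      ← sum_erase_zero_mulChar_of_forall_eq_one η h, sum_mul]
    simp_rw [map_mul, ← mul_sum]
    rfl
  have h1 : ∑ t ∈ univ.erase (0 : K), canonicalAddChar p K t = -1 := by
    have := sum_canonicalAddChar p K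
    rw [← add_sum_erase _ _ (mem_univ (0 : K)), AddChar.map_zero_eq_one] at this
    linear_combination this
  have h2 : gaussSum' p L η = T + -1 * S := by
    rw [gaussSum', sum_eq_sum_trace_zero_add (K := K), ← h1, sum_mul]
    congr 1
    · refine sum_congr rfl fun x hx ↦ ?_
      rw [← canonicalAddChar_apply, ← canonicalAddChar_trace p (K := K), (mem_filter.mp hx).2,
        AddChar.map_zero_eq_one, mul_one]
    · refine sum_congr rfl fun t ht ↦ ?_
      rw [mul_sum]
      refine sum_congr rfl fun u hu ↦ ?_
      rw [← canonicalAddChar_apply, ← canonicalAddChar_trace p (K := K), ← Algebra.smul_def,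
        (Algebra.trace K L).map_smul, (mem_filter.mp hu).2, smul_eq_mul, mul_one,
        Algebra.smul_def, map_mul, h t (ne_of_mem_erase ht), one_mul, mul_comm]
  linear_combination h2 - h0

end GaussSums

theorem curveCard_eq_sum {K L : Type} [Field K] [Field L] [Fintype K] [Fintype L] [Algebra K L]
    (χ : MulChar L ℂ) (a b : L) :
    (curveCard K L (orderOf χ) a b : ℂ) = Fintype.card L + ∑ ℓ ∈ Icc 1 (orderOf χ - 1),
      ∑ x, (χ ^ ℓ) (a * x * algebraMap K L (Algebra.trace K L x) + b) := by
  have e : {xy : L × L // xy.2 ^ orderOf χ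
        = a * xy.1 * algebraMap K L (Algebra.trace K L xy.1) + b}
      ≃ Σ x : L, {y : L // y ^ orderOf χ = a * x * algebraMap K L (Algebra.trace K L x) + b} :=
    { toFun := fun z ↦ ⟨z.1.1, z.1.2, z.2⟩
      invFun := fun z ↦ ⟨(z.1, z.2.1), z.2.2⟩
      left_inv := fun _ ↦ rfl
      right_inv := fun _ ↦ rfl }
  rw [curveCard, Nat.card_congr e, Nat.card_sigma, Nat.cast_sum]
  simp_rw [natCard_pow_eq_sum_mulChar]
  rw [sum_add_distrib, sum_comm]
  simp

theorem sum_Icc_filter_dvd {D v : ℕ} (hD : 0 < D) (f : ℕ → ℂ) :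
    ∑ ℓ ∈ Icc 1 (v * D - 1) with D ∣ ℓ, f ℓ = ∑ j ∈ Icc 1 (v - 1), f (j * D) := by
  symm
  refine sum_bij' (fun j _ ↦ j * D) (fun ℓ _ ↦ ℓ / D) ?_ ?_ ?_ ?_ ?_
  · intro j hj
    rw [mem_Icc] at hj
    rw [mem_filter, mem_Icc]
    have h1 : j * D < v * D := Nat.mul_lt_mul_of_pos_right (by omega) hD
    have h2 : 0 < j * D := Nat.mul_pos (by omega) hD
    exact ⟨⟨h2, by omega⟩, dvd_mul_left _ _⟩
  · intro ℓ hℓ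
    rw [mem_filter, mem_Icc] at hℓ
    obtain ⟨⟨h1, h2⟩, k, rfl⟩ := hℓ
    rw [Nat.mul_div_cancel_left _ hD, mem_Icc]
    have hk : 0 < k := Nat.pos_of_mul_pos_left h1
    have : k < v := Nat.lt_of_mul_lt_mul_left (a := D) (by rw [mul_comm D v]; omega)
    omega
  · intro j _
    exact Nat.mul_div_cancel _ hD
  · intro ℓ hℓ
    exact Nat.div_mul_cancel (mem_filter.mp hℓ).2
  · intro j _
    rfl

theorem curve_card_D_odd_B_zero (p s n : ℕ) [Fact p.Prime] (hp : Odd p) (hs : 0 < s)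
    (hn : 0 < n) (q : ℕ) (hq : q = p ^ s)
    (Fq Fqn : Type) [Field Fq] [Field Fqn] [Fintype Fq] [Fintype Fqn] [Algebra Fq Fqn]
    [CharP Fqn p]
    (hcard : Fintype.card Fq = q) (hcardn : Fintype.card Fqn = q ^ n)
    (d : ℕ) (hd : d ∣ q ^ n - 1) (a : Fqn) (ha : a ≠ 0) (b : Fqn)
    (χ : MulChar Fqn ℂ) (hχ : orderOf χ = d)
    (v D : ℕ) (hv : v = Nat.gcd d ((q ^ n - 1) / (q - 1))) (hD : D = d / v)
    (hDodd : Odd D) (hB : Algebra.trace Fq Fqn (b / a) = 0) :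
    (curveCard Fq Fqn d a b : ℂ)
      = (q : ℂ) ^ n + (q : ℂ) ^ (n - 1) * ∑ ℓ ∈ Finset.Icc 1 (d - 1), (χ ^ ℓ) b
        - (((q : ℂ) - 1) / q) *
            ∑ j ∈ Finset.Icc 1 (v - 1), gaussSum' p Fqn (χ ^ (j * D)) * (χ ^ (j * D)) (-a) := by
  classical
  have : CharP Fq p := (Algebra.charP_iff Fq Fqn p).mpr inferInstance
  have hq0 : (q : ℂ) ≠ 0 := by
    rw [← hcard]; exact_mod_cast Fintype.card_ne_zero
  have hd0 : 0 < d := hχ ▸ χ.orderOf_pos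
  have hvd : v ∣ d := hv ▸ Nat.gcd_dvd_left _ _
  have hdv : d = v * D := by rw [hD, Nat.mul_div_cancel' hvd]
  have hD0 : 0 < D := Nat.pos_of_ne_zero fun h ↦ by simp [h] at hdv; omega
  have hv0 : 0 < v := Nat.pos_of_ne_zero fun h ↦ by simp [h] at hdv; omega
  set N := (q ^ n - 1) / (q - 1) with hN
  have hdvd : ∀ m, d ∣ m * N ↔ D ∣ m := fun m ↦ by
    have hco : Nat.Coprime D (N / v) := by
      rw [hD, hv]
      exact Nat.coprime_div_gcd_div_gcd (hv ▸ hv0)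
    have hNv : N = v * (N / v) := (Nat.mul_div_cancel' (hv ▸ Nat.gcd_dvd_right _ _)).symm
    nth_rw 1 [hdv, hNv]
    rw [ mul_left_comm, Nat.mul_dvd_mul_iff_left hv0]
    exact hco.dvd_mul_right
  have htriv : ∀ m, (∀ t : Fq, t ≠ 0 → (χ ^ m) (algebraMap Fq Fqn t) = 1) ↔ D ∣ m := fun m ↦ by
    rw [forall_mulChar_algebraMap_eq_one_iff, hcard, hcardn, ← pow_mul, ← hdvd, ← hχ]
    exact orderOf_dvd_iff_pow_eq_one.symm
  have hker : (#{x : Fqn | Algebra.trace Fq Fqn x = 0} : ℂ) = (q : ℂ) ^ (n - 1) := by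
    have h := card_mul_card_trace_eq_zero_s18 (K := Fq) (L := Fqn)
    rw [hcard, hcardn, ← Nat.succ_pred_eq_of_pos hn, pow_succ'] at h
    exact_mod_cast Nat.eq_of_mul_eq_mul_left
      (Nat.pos_of_ne_zero fun h0 ↦ hq0 (by exact_mod_cast h0)) h
  have hterm : ∀ ℓ ∈ Icc 1 (d - 1),
      ∑ x, (χ ^ ℓ) (a * x * algebraMap Fq Fqn (Algebra.trace Fq Fqn x) + b)
        = (q : ℂ) ^ (n - 1) * (χ ^ ℓ) b
          - if D ∣ ℓ then (((q : ℂ) - 1) / q) * (gaussSum' p Fqn (χ ^ ℓ) * (χ ^ ℓ) (-a))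
            else 0 := by
    intro ℓ hℓ
    rw [mem_Icc] at hℓ
    rw [sum_mulChar_mul_trace_add_s18 _ ha hB, hker, ← pow_mul]
    split_ifs with h
    · have h1 := (htriv ℓ).mpr h
      have hne : χ ^ ℓ ≠ 1 := pow_ne_one_of_lt_orderOf (by omega) (by omega)
      have hneg : (χ ^ ℓ) (-a) = (χ ^ ℓ) a := by
        have := h1 (-1) (neg_ne_zero.mpr one_ne_zero)
        rw [map_neg, map_one] at this
        rw [← neg_one_mul, map_mul, this, one_mul]
      rw [sum_erase_zero_mulChar_of_forall_eq_one _ ((htriv (ℓ * 2)).mpr (h.mul_right 2)), hneg,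
        gaussSum'_eq_neg_card_mul_sum_trace_eq_one p hne h1, hcard]
      field_simp
      ring
    · have h2 : ¬ D ∣ ℓ * 2 := fun h' ↦
        h ((Nat.coprime_two_right.mpr hDodd).dvd_of_dvd_mul_right h')
      rw [← htriv] at h2
      push Not at h2
      rw [sum_erase_zero_mulChar_of_exists_ne_one _ h2]
      simp
  subst hχ
  rw [curveCard_eq_sum, sum_congr rfl hterm, sum_sub_distrib, ← mul_sum, ← sum_filter, ← mul_sum,
    hcardn, Nat.cast_pow]
  rw [show Icc 1 (orderOf χ - 1) = Icc 1 (v * D - 1) by rw [← hdv], sum_Icc_filter_dvd hD0]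
  ring
end
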